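/- arXiv:math/0509045 — 2 statements merged into one kernel-verified Lean document; each statement's English description precedes it below -/
import Mathlib

section
/- Let p ≥ 1, n ≥ 1, let g₁,…,g_p and h_{ij} (1 ≤ i,j ≤ p, with h_{ij} = h_{ji}) be holomorphic functions on an open neighborhood U of 0 in ℂⁿ with g_i(0) = 0, and set f = Σ_{i,j=1}^p h_{ij} g_i g_j. Let [H] be the symmetric p×p matrix of functions with entries h_{ij}, and assume det [H(0)] ≠ 0. Then there exist an open neighborhood V ⊆ U of 0, holomorphic functions g'₁,…,g'_p on V, and a holomorphic map R : V → Matrix (Fin p) (Fin p) ℂ with R(z) invertible for every z ∈ V, such that g_i(z) = Σ_j R(z)_{ij} g'_j(z) on V (in particular the germs of g₁,…,g_p and of g'₁,…,g'_p at 0 generate the same ideal of the ring of analytic germs O_n) and f(z) = Σ_{i=1}^p (g'_i(z))² for all z ∈ V. (Lemma 3.3 of the paper.) -/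
open Filter Topology

set_option maxHeartbeats 1000000
set_option synthInstance.maxHeartbeats 400000

noncomputable section

/-- `ℂⁿ`. -/
abbrev Cn (n : ℕ) : Type := Fin n → ℂ

/-- `Filter.Germ l ℂ` is a `ℂ`-algebra via constant germs. -/
instance germAlgebra {α : Type*} (l : Filter α) : Algebra ℂ (Filter.Germ l ℂ) :=
  ((Filter.Germ.coeRingHom l).comp (Pi.constRingHom α ℂ)).toAlgebra

/-- The local ring `O_n` of germs at `0` of holomorphic functions `ℂⁿ → ℂ`,
realized as the subalgebra of `Filter.Germ (𝓝 0) ℂ` consisting of germs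
having a representative analytic on a neighborhood of `0`. -/
def On (n : ℕ) : Subalgebra ℂ (Filter.Germ (𝓝 (0 : Cn n)) ℂ) where
  carrier := {φ | ∃ f : Cn n → ℂ, AnalyticAt ℂ f 0 ∧ φ = ↑f}
  mul_mem' := by
    rintro a b ⟨f, hf, rfl⟩ ⟨g, hg, rfl⟩
    exact ⟨f * g, hf.mul hg, rfl⟩
  one_mem' := ⟨1, analyticAt_const, rfl⟩
  add_mem' := by
    rintro a b ⟨f, hf, rfl⟩ ⟨g, hg, rfl⟩
    exact ⟨f + g, hf.add hg, rfl⟩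
  zero_mem' := ⟨0, analyticAt_const, rfl⟩
  algebraMap_mem' := fun c => ⟨fun _ => c, analyticAt_const, rfl⟩

/-- The ideal of `O_n` generated by the germs at `0` of a set of functions. -/
def idealOfFuns {n : ℕ} (s : Set (Cn n → ℂ)) : Ideal (On n) :=
  Ideal.span {x : On n | ∃ f ∈ s, (x : Filter.Germ (𝓝 (0 : Cn n)) ℂ) = ↑f}

/-- The `i`-th partial derivative `∂f/∂zᵢ` of `f : ℂⁿ → ℂ`. -/
def pder {n : ℕ} (f : Cn n → ℂ) (i : Fin n) : Cn n → ℂ :=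
  fun z => fderiv ℂ f z (Pi.single i 1)

/-- The jacobian ideal `J(f)` of `O_n`, generated by the germs at `0` of the
partial derivatives of `f`. -/
def jacobianIdeal {n : ℕ} (f : Cn n → ℂ) : Ideal (On n) :=
  idealOfFuns (Set.range (pder f))

/-- For ideals `J ⊆ I` of `O_n`, the quotient `I/J`, realized as the
`ℂ`-subspace of `O_n ⧸ J` given by the image of `I`. -/
def quotIJ {n : ℕ} (I J : Ideal (On n)) : Submodule ℂ ((On n) ⧸ J) :=
  (I.map (Ideal.Quotient.mk J)).restrictScalars ℂ

/-- `f` has a singularity of type `A(d)` at `x ∈ ℂⁿ` (with `r = n - d`):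
there is a biholomorphism `φ` from a neighborhood of `0` in `ℂ^d × ℂ^r` onto a
neighborhood of `x` with `φ 0 = x` and `f (φ (z, w)) - f x = w₁² + ⋯ + w_r²`. -/
def HasAdSingularityAt (n d r : ℕ) (f : Cn n → ℂ) (x : Cn n) : Prop :=
  ∃ (V : Set ((Fin d → ℂ) × (Fin r → ℂ))) (W : Set (Cn n))
    (φ : (Fin d → ℂ) × (Fin r → ℂ) → Cn n) (ψ : Cn n → (Fin d → ℂ) × (Fin r → ℂ)),
    IsOpen V ∧ IsOpen W ∧ (0 : (Fin d → ℂ) × (Fin r → ℂ)) ∈ V ∧ x ∈ W ∧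
    φ 0 = x ∧ AnalyticOnNhd ℂ φ V ∧ AnalyticOnNhd ℂ ψ W ∧
    Set.MapsTo φ V W ∧ Set.MapsTo ψ W V ∧
    (∀ q ∈ V, ψ (φ q) = q) ∧ (∀ y ∈ W, φ (ψ y) = y) ∧
    ∀ q ∈ V, f (φ q) - f x = ∑ i, (q.2 i) ^ 2

/-- A nondegenerate symmetric matrix over an algebraically closed field is of the form `Pᵀ P`. -/
theorem Matrix.IsSymm.exists_eq_transpose_mul_self {K : Type*} [Field K] [IsAlgClosed K]
    [Invertible (2 : K)] {ι : Type*} [Fintype ι] [DecidableEq ι] {A : Matrix ι ι K}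
    (hA : A.IsSymm) (hdet : A.det ≠ 0) : ∃ P : Matrix ι ι K, A = P.transpose * P := by
  have key : ∀ B : Matrix ι ι K, B.IsSymm →
      QuadraticMap.associated (R := K) B.toQuadraticForm' = Matrix.toLinearMap₂' K B := by
    intro B hB
    refine QuadraticMap.associated_left_inverse K fun x y => ?_
    rw [Matrix.toLinearMap₂'_apply', Matrix.toLinearMap₂'_apply', Matrix.dotProduct_mulVec,
      ← Matrix.mulVec_transpose, hB.eq, dotProduct_comm]
  obtain ⟨e⟩ := QuadraticForm.equivalent_of_isAlgClosed A.toQuadraticForm'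
    (1 : Matrix ι ι K).toQuadraticForm'
    (by rw [key A hA]; exact LinearMap.separatingLeft_toLinearMap₂'_iff_det_ne_zero.2 hdet)
    (by rw [key 1 Matrix.isSymm_one]
        exact LinearMap.separatingLeft_toLinearMap₂'_iff_det_ne_zero.2 (by simp))
  have hcomp : A.toQuadraticForm' =
      (1 : Matrix ι ι K).toQuadraticForm'.comp (e.toLinearEquiv : (ι → K) →ₗ[K] (ι → K)) := by
    ext x
    exact (e.map_app x).symm
  refine ⟨LinearMap.toMatrix' (e.toLinearEquiv : (ι → K) →ₗ[K] (ι → K)), ?_⟩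
  have h := congrArg (QuadraticMap.associated (R := K)) hcomp
  rw [QuadraticMap.associated_comp, key A hA, key 1 Matrix.isSymm_one] at h
  have h' := congrArg (LinearMap.toMatrix₂' K) h
  rw [LinearMap.toMatrix₂'_compl₁₂] at h'
  simpa using h'

/-- Near `1`, squaring in a complex Banach algebra has an analytic local inverse. -/
theorem exists_analyticAt_sqrt_one (A : Type*) [NormedRing A] [NormedAlgebra ℂ A]
    [CompleteSpace A] : ∃ s : A → A, AnalyticAt ℂ s 1 ∧ s 1 = 1 ∧
      (∀ᶠ x in 𝓝 1, s x * s x = x) ∧ ∀ᶠ x in 𝓝 1, s (x * x) = x := by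
  have hf : AnalyticAt ℂ (fun x : A => x * x) 1 := analyticAt_id.mul analyticAt_id
  have hd : HasFDerivAt (fun x : A => x * x)
      (ContinuousLinearEquiv.smulLeft (R₁ := ℂ) (M₁ := A) (Units.mk0 (2 : ℂ) two_ne_zero) :
        A →L[ℂ] A) 1 := by
    convert! (hasFDerivAt_id (𝕜 := ℂ) (1 : A)).mul' (hasFDerivAt_id (𝕜 := ℂ) (1 : A)) using 1
    ext x
    simp [Units.smul_def, two_smul]
  have hs := hf.contDiffAt (n := ⊤) |>.hasStrictFDerivAt' hd (by simp)
  have hc := (hf.contDiffAt (n := ⊤)).to_localInverse hd (by simp)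
  refine ⟨hs.localInverse _ _ _, ?_, ?_, ?_, hs.eventually_left_inverse⟩
  · simpa [ContDiffAt.localInverse] using hc.analyticAt
  · simpa using hs.localInverse_apply_image
  · simpa using hs.eventually_right_inverse

open scoped Matrix Matrix.Norms.Operator in
/-- Complex symmetric matrices `X` near a nondegenerate one factor as `T Tᵀ` with `T` depending
analytically on `X`. -/
theorem Matrix.IsSymm.exists_analyticAt_mul_transpose {ι : Type*} [Fintype ι] [DecidableEq ι]
    {A : Matrix ι ι ℂ} (hA : A.IsSymm) (hdet : A.det ≠ 0) :
    ∃ T : Matrix ι ι ℂ → Matrix ι ι ℂ, AnalyticAt ℂ T A ∧ IsUnit (T A) ∧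
      ∀ᶠ X in 𝓝 A, X.IsSymm → T X * (T X)ᵀ = X := by
  obtain ⟨P, hP⟩ := hA.exists_eq_transpose_mul_self hdet
  obtain ⟨s, hs, hs1, hsq, hsl⟩ := exists_analyticAt_sqrt_one (Matrix ι ι ℂ)
  have hu : IsUnit A.det := isUnit_iff_ne_zero.2 hdet
  have hAA : A * A⁻¹ = 1 := Matrix.mul_nonsing_inv A hu
  have hAA' : A⁻¹ * A = 1 := Matrix.nonsing_inv_mul A hu
  have hB : AnalyticAt ℂ (fun X : Matrix ι ι ℂ => X * A⁻¹) A := analyticAt_id.mul analyticAt_const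
  have hBt : Tendsto (fun X : Matrix ι ι ℂ => X * A⁻¹) (𝓝 A) (𝓝 1) := by
    have h := hB.continuousAt.tendsto
    simp only [hAA] at h
    exact h
  have hC : AnalyticAt ℂ (fun X : Matrix ι ι ℂ => s (X * A⁻¹)) A :=
    AnalyticAt.fun_comp (by rwa [hAA]) hB
  have hD : Tendsto (fun X : Matrix ι ι ℂ => A * (s (X * A⁻¹))ᵀ * A⁻¹) (𝓝 A) (𝓝 1) := by
    have h : ContinuousAt (fun X : Matrix ι ι ℂ => A * (s (X * A⁻¹))ᵀ * A⁻¹) A :=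
      (continuousAt_const.mul
        ((continuous_id.matrix_transpose.continuousAt).comp hC.continuousAt)).mul
        continuousAt_const
    simpa [hAA, hs1] using h.tendsto
  refine ⟨fun X => s (X * A⁻¹) * Pᵀ, hC.mul analyticAt_const, ?_, ?_⟩
  · simp only [hAA, hs1, one_mul]
    rw [Matrix.isUnit_iff_isUnit_det, isUnit_iff_ne_zero]
    intro h
    exact hdet (by rw [hP, Matrix.det_mul, h, zero_mul])
  · filter_upwards [hBt.eventually hsq, hD.eventually hsl] with X hX hXD hXs
    set C := s (X * A⁻¹)
    have hsquare : A * Cᵀ * A⁻¹ * (A * Cᵀ * A⁻¹) = X * A⁻¹ := by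
      calc A * Cᵀ * A⁻¹ * (A * Cᵀ * A⁻¹) = A * Cᵀ * (A⁻¹ * A) * (Cᵀ * A⁻¹) := by noncomm_ring
        _ = A * (C * C)ᵀ * A⁻¹ := by rw [hAA', Matrix.transpose_mul]; noncomm_ring
        _ = (A * A⁻¹) * X * A⁻¹ := by
          rw [hX, Matrix.transpose_mul, hXs.eq, Matrix.transpose_nonsing_inv, hA.eq]
          noncomm_ring
        _ = X * A⁻¹ := by rw [hAA, one_mul]
    have hCD : C = A * Cᵀ * A⁻¹ := by rw [hsquare] at hXD; exact hXD
    calc C * Pᵀ * (C * Pᵀ)ᵀ = C * (Pᵀ * P) * Cᵀ := by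
          rw [Matrix.transpose_mul, Matrix.transpose_transpose]; noncomm_ring
      _ = C * (A * Cᵀ) := by rw [← hP, mul_assoc]
      _ = C * (A * Cᵀ * (A⁻¹ * A)) := by rw [hAA', mul_one]
      _ = C * (A * Cᵀ * A⁻¹) * A := by noncomm_ring
      _ = C * C * A := by rw [← hCD]
      _ = X := by rw [hX, mul_assoc, hAA', mul_one]

/-- Families of analytic germs that are `O_n`-linear combinations of the germs of another family
generate a smaller ideal. -/
theorem idealOfFuns_range_le {n : ℕ} {ι κ : Type*} [Fintype κ] {f : ι → Cn n → ℂ}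
    {b : κ → Cn n → ℂ} {a : ι → κ → Cn n → ℂ} (hb : ∀ j, AnalyticAt ℂ (b j) 0)
    (ha : ∀ i j, AnalyticAt ℂ (a i j) 0)
    (hf : ∀ i, ∀ᶠ z in 𝓝 0, f i z = ∑ j, a i j z * b j z) :
    idealOfFuns (Set.range f) ≤ idealOfFuns (Set.range b) := by
  refine Ideal.span_le.2 ?_
  rintro x ⟨_, ⟨i, rfl⟩, hx⟩
  have hsum : x = ∑ j, (⟨↑(a i j), a i j, ha i j, rfl⟩ : On n) * ⟨↑(b j), b j, hb j, rfl⟩ := by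
    refine Subtype.ext ?_
    rw [hx, AddSubmonoidClass.coe_finsetSum]
    have h : ((∑ j, a i j * b j : Cn n → ℂ) : Filter.Germ (𝓝 (0 : Cn n)) ℂ) =
        ∑ j, (↑(a i j * b j) : Filter.Germ (𝓝 (0 : Cn n)) ℂ) :=
      map_sum (Filter.Germ.coeRingHom (R := ℂ) (𝓝 (0 : Cn n))) _ _
    refine Eq.trans ?_ h
    refine Filter.Germ.coe_eq.2 ?_
    filter_upwards [hf i] with z hz
    simp [hz]
  rw [hsum]
  exact Ideal.sum_mem _ fun j _ => Ideal.mul_mem_left _ _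
    (Ideal.subset_span ⟨b j, ⟨j, rfl⟩, rfl⟩)

open scoped Matrix.Norms.Operator in
/-- A matrix-valued function is analytic if and only if its entries are. -/
theorem Matrix.analyticAt_iff {E ι : Type*} [NormedAddCommGroup E] [NormedSpace ℂ E] [Fintype ι]
    [DecidableEq ι] {M : E → Matrix ι ι ℂ} {z : E} :
    AnalyticAt ℂ M z ↔ ∀ i j, AnalyticAt ℂ (fun w => M w i j) z := by
  constructor
  · intro hM i j
    exact ((Matrix.entryLinearMap ℂ ℂ i j).toContinuousLinearMap.analyticAt (M z)).fun_comp hM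
  · intro hM
    have h : AnalyticAt ℂ (fun w i j => M w i j) z :=
      AnalyticAt.pi fun i => AnalyticAt.pi fun j => hM i j
    exact (((Matrix.ofLinearEquiv ℂ : (ι → ι → ℂ) ≃ₗ[ℂ] Matrix ι ι ℂ) :
      (ι → ι → ℂ) →ₗ[ℂ] Matrix ι ι ℂ).toContinuousLinearMap.analyticAt _).fun_comp h

/-- **Lemma 3.3.** If `f = Σᵢⱼ hᵢⱼ gᵢ gⱼ` with `[H] = (hᵢⱼ)` symmetric and
`det [H(0)] ≠ 0`, then there are a neighborhood `V ⊆ U` of `0`, holomorphic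
functions `g'₁, …, g'_p` on `V`, and a holomorphic invertible-matrix-valued map
`R` with `gᵢ = Σⱼ Rᵢⱼ g'ⱼ` on `V` (in particular the germs of the `gᵢ` and of
the `g'ᵢ` generate the same ideal of `O_n`) and `f = Σᵢ (g'ᵢ)²` on `V`. -/
theorem lemma_3_3 (p n : ℕ) (hp : 1 ≤ p) (hn : 1 ≤ n)
    (U : Set (Cn n)) (hU : IsOpen U) (h0U : (0 : Cn n) ∈ U)
    (g : Fin p → Cn n → ℂ) (h : Fin p → Fin p → Cn n → ℂ)
    (hg : ∀ i, AnalyticOnNhd ℂ (g i) U)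
    (hh : ∀ i j, AnalyticOnNhd ℂ (h i j) U)
    (hsymm : ∀ i j, h i j = h j i)
    (hg0 : ∀ i, g i 0 = 0)
    (f : Cn n → ℂ) (hf : ∀ z, f z = ∑ i, ∑ j, h i j z * g i z * g j z)
    (hdet : (Matrix.of fun i j => h i j 0).det ≠ 0) :
    ∃ V : Set (Cn n), V ⊆ U ∧ IsOpen V ∧ (0 : Cn n) ∈ V ∧
      ∃ (g' : Fin p → Cn n → ℂ) (R : Cn n → Matrix (Fin p) (Fin p) ℂ),
        (∀ i, AnalyticOnNhd ℂ (g' i) V) ∧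
        (∀ i j, AnalyticOnNhd ℂ (fun z => R z i j) V) ∧
        (∀ z ∈ V, IsUnit (R z)) ∧
        (∀ z ∈ V, ∀ i, g i z = ∑ j, R z i j * g' j z) ∧
        idealOfFuns (Set.range g) = idealOfFuns (Set.range g') ∧
        (∀ z ∈ V, f z = ∑ i, (g' i z) ^ 2) := by
  open scoped Matrix Matrix.Norms.Operator in
  set H : Cn n → Matrix (Fin p) (Fin p) ℂ := fun z => Matrix.of fun i j => h i j z
  have hHs : ∀ z, (H z).IsSymm := fun z => Matrix.IsSymm.ext fun i j => by simp [H, hsymm i j]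
  obtain ⟨T, hT, hTu, hTe⟩ := (hHs 0).exists_analyticAt_mul_transpose hdet
  have hHa : AnalyticAt ℂ H 0 := Matrix.analyticAt_iff.2 fun i j => hh i j 0 h0U
  have hTH : AnalyticAt ℂ (fun z => T (H z)) 0 := AnalyticAt.fun_comp hT hHa
  set W : Cn n → Matrix (Fin p) (Fin p) ℂ := fun z => (T (H z)).transpose
  have hWa : AnalyticAt ℂ W 0 :=
    Matrix.analyticAt_iff.2 fun i j => Matrix.analyticAt_iff.1 hTH j i
  have hWu : IsUnit (W 0) := (Matrix.isUnit_transpose (T (H 0))).2 hTu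
  set R : Cn n → Matrix (Fin p) (Fin p) ℂ := fun z => Ring.inverse (W z)
  have hRa : AnalyticAt ℂ R 0 := by
    refine AnalyticAt.fun_comp ?_ hWa
    obtain ⟨u, hu⟩ := hWu
    rw [← hu]
    exact analyticAt_inverse u
  have hWe : ∀ᶠ z in 𝓝 (0 : Cn n), IsUnit (W z) :=
    hWa.continuousAt.eventually (Units.isOpen.mem_nhds hWu)
  have hev : ∀ᶠ z in 𝓝 (0 : Cn n), z ∈ U ∧ AnalyticAt ℂ W z ∧ AnalyticAt ℂ R z ∧
      IsUnit (W z) ∧ T (H z) * (T (H z)).transpose = H z := by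
    filter_upwards [hU.mem_nhds h0U, hWa.eventually_analyticAt, hRa.eventually_analyticAt, hWe,
      hHa.continuousAt.eventually hTe] with z h1 h2 h3 h4 h5
    exact ⟨h1, h2, h3, h4, h5 (hHs z)⟩
  obtain ⟨V, hV, hVo, h0V⟩ := eventually_nhds_iff.1 hev
  have hga : ∀ z ∈ V, ∀ i, AnalyticAt ℂ (fun z => ∑ j, W z i j * g j z) z := fun z hz i =>
    Finset.analyticAt_fun_sum _ fun j _ =>
      (Matrix.analyticAt_iff.1 (hV z hz).2.1 i j).mul (hg j z (hV z hz).1)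
  have hgR : ∀ z ∈ V, ∀ i, g i z = ∑ j, R z i j * ∑ k, W z j k * g k z := by
    intro z hz i
    have hRW : R z * W z = 1 := Ring.inverse_mul_cancel _ (hV z hz).2.2.2.1
    have := congrFun (Matrix.mulVec_mulVec (fun k => g k z) (R z) (W z)) i
    rw [hRW, Matrix.one_mulVec] at this
    exact this.symm
  refine ⟨V, fun z hz => (hV z hz).1, hVo, h0V, fun i z => ∑ j, W z i j * g j z, R,
    fun i z hz => hga z hz i, fun i j z hz => Matrix.analyticAt_iff.1 (hV z hz).2.2.1 i j,
    fun z hz => (hV z hz).2.2.2.1.ringInverse, hgR, le_antisymm ?_ ?_, ?_⟩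
  · exact idealOfFuns_range_le (hga 0 h0V) (fun i j => Matrix.analyticAt_iff.1 hRa i j)
      fun i => Filter.mem_of_superset (hVo.mem_nhds h0V) fun z hz => hgR z hz i
  · exact idealOfFuns_range_le (fun j => hg j 0 h0U)
      (fun i j => Matrix.analyticAt_iff.1 hWa i j) fun i => Eventually.of_forall fun z => rfl
  · intro z hz
    have hHW : H z = (W z).transpose * W z := by
      simpa [W] using (hV z hz).2.2.2.2.symm
    calc f z = (fun i => g i z) ⬝ᵥ (H z).mulVec fun i => g i z := by
          rw [hf]
          simp only [dotProduct, Matrix.mulVec, Finset.mul_sum, H, Matrix.of_apply]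
          exact Finset.sum_congr rfl fun i _ => Finset.sum_congr rfl fun j _ => by ring
      _ = (W z).mulVec (fun i => g i z) ⬝ᵥ (W z).mulVec fun i => g i z := by
          rw [hHW, ← Matrix.mulVec_mulVec, Matrix.dotProduct_mulVec, Matrix.vecMul_transpose]
      _ = ∑ i, (∑ j, W z i j * g j z) ^ 2 :=
          Finset.sum_congr rfl fun i _ => (pow_two _).symm

end
end

section
/- Let n > p ≥ 1 with d = n − p > 1. Let g₁,…,g_p be holomorphic on a neighborhood of 0 in ℂⁿ with g_i(0) = 0, generating an ideal I of O_n such that O_n/I is reduced and has Krull dimension d (so V(I) = {g₁ = ⋯ = g_p = 0} is a reduced complete intersection of dimension d > 1). Let h_{ij} = h_{ji} be holomorphic near 0, set f = Σ_{i,j=1}^p h_{ij} g_i g_j (so that the jacobian ideal satisfies J(f) ⊆ I), and assume that near 0 the critical locus S(f) = {z : df(z) = 0} coincides with V(I). If the symmetric matrix [H] = (h_{ij}) satisfies det [H(0)] = 0, then: (i) every neighborhood of 0 contains points x ∈ V(I), x ≠ 0, at which f does not have a singularity of type A(d); and (ii) the quotient I/J(f) is NOT a finite-dimensional ℂ-vector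 space, i.e. j(f) = ∞. (Proposition 3.1 of the paper.) -/
open Filter Topology

set_option maxHeartbeats 1000000
set_option synthInstance.maxHeartbeats 400000

noncomputable section

section Superposition

variable {K F : Type*} [TopologicalSpace K] [CompactSpace K] [NormedAddCommGroup F]
  [NormedSpace ℂ F]

/-- Pointwise application of a continuous multilinear form to continuous maps on a compact
space. -/
def pointwiseMultilinear {k : ℕ} (p : F [×k]→L[ℂ] ℂ) : C(K, F) [×k]→L[ℂ] C(K, ℂ) :=
  MultilinearMap.mkContinuous
    { toFun := fun φ => ⟨fun x => p fun i => φ i x, by fun_prop⟩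
      map_update_add' := by
        intro _ φ i a b
        ext x
        have h : ∀ c : C(K, F), (fun j => Function.update φ i c j x)
            = Function.update (fun j => φ j x) i (c x) := by
          intro c; ext1 j; rcases eq_or_ne j i with rfl | hj <;> simp [*]
        simp [h]
      map_update_smul' := by
        intro _ φ i a b
        ext x
        have h : ∀ c : C(K, F), (fun j => Function.update φ i c j x)
            = Function.update (fun j => φ j x) i (c x) := by
          intro c; ext1 j; rcases eq_or_ne j i with rfl | hj <;> simp [*]
        simp [h] }
    ‖p‖ (by
      intro φ
      rw [ContinuousMap.norm_le _ (by positivity)]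
      intro x
      refine (p.le_opNorm _).trans ?_
      gcongr with i
      exact (φ i).norm_coe_le_norm x)

theorem norm_pointwiseMultilinear_le {k : ℕ} (p : F [×k]→L[ℂ] ℂ) :
    ‖(pointwiseMultilinear p : C(K, F) [×k]→L[ℂ] C(K, ℂ))‖ ≤ ‖p‖ :=
  MultilinearMap.mkContinuous_norm_le _ (norm_nonneg _) _

/-- The superposition operator `φ ↦ f ∘ φ` on continuous maps is analytic when `f` is. -/
theorem exists_superposition {f : F → ℂ} {p : FormalMultilinearSeries ℂ F ℂ} {r : ENNReal}
    (hf : HasFPowerSeriesOnBall f p 0 r) :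
    ∃ N : C(K, F) → C(K, ℂ), ∀ φ ∈ Metric.eball (0 : C(K, F)) r,
      AnalyticAt ℂ N φ ∧ ∀ x, N φ x = f (φ x) := by
  let P : FormalMultilinearSeries ℂ C(K, F) C(K, ℂ) := fun k => pointwiseMultilinear (p k)
  have hrad : p.radius ≤ P.radius := by
    refine FormalMultilinearSeries.radius_le_of_le (fun k => ?_)
    exact norm_pointwiseMultilinear_le (p k)
  have hP : HasFPowerSeriesOnBall P.sum P 0 r :=
    (P.hasFPowerSeriesOnBall ((hf.r_pos.trans_le hf.r_le).trans_le hrad)).mono hf.r_pos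
      (hf.r_le.trans hrad)
  refine ⟨P.sum, fun φ hφ => ⟨hP.analyticAt_of_mem hφ, fun x => ?_⟩⟩
  have h1 := hP.hasSum (y := φ) hφ
  have h2 := h1.mapL (ContinuousMap.evalCLM ℂ x)
  have h3 := hf.hasSum (y := φ x) (by
    rw [mem_eball_zero_iff] at hφ ⊢
    refine lt_of_le_of_lt ?_ hφ
    rw [enorm_le_iff_norm_le]
    exact φ.norm_coe_le_norm x)
  simp only [zero_add] at h2 h3
  exact h2.unique h3

end Superposition

section Weierstrass

variable {E : Type*} [NormedAddCommGroup E] [NormedSpace ℂ E]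

open Metric in
/-- An analytic function `f (z, t)` near `0`, viewed as an analytic map from `z` to functions on a
small circle. -/
theorem exists_restrict_sphere {f : E × ℂ → ℂ} (hf : AnalyticAt ℂ f 0) :
    ∃ r > 0, ∀ ρ > 0, ρ < r → ∃ Fh : E → C(sphere (0 : ℂ) ρ, ℂ), AnalyticAt ℂ Fh 0 ∧
      ∀ᶠ z in 𝓝 0, (∀ ζ, Fh z ζ = f (z, ζ)) ∧
        ∀ t ∈ closedBall (0 : ℂ) ρ, DifferentiableAt ℂ (fun t => f (z, t)) t := by
  obtain ⟨p, R, hp⟩ := hf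
  obtain ⟨r, hr0, hrR⟩ : ∃ r : ℝ, 0 < r ∧ ENNReal.ofReal r ≤ R := by
    rcases eq_or_ne R ⊤ with rfl | hR
    · exact ⟨1, one_pos, le_top⟩
    · exact ⟨R.toReal, ENNReal.toReal_pos hp.r_pos.ne' hR, (ENNReal.ofReal_toReal hR).le⟩
  refine ⟨r, hr0, fun ρ hρ hρr => ?_⟩
  obtain ⟨N, hN⟩ := exists_superposition (K := sphere (0 : ℂ) ρ) hp
  let ι : C(sphere (0 : ℂ) ρ, E × ℂ) := ⟨fun ζ => (0, ζ), by fun_prop⟩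
  let A : E → C(sphere (0 : ℂ) ρ, E × ℂ) := fun z =>
    ContinuousLinearMap.const ℂ (sphere (0 : ℂ) ρ) (ContinuousLinearMap.inl ℂ E ℂ z) + ι
  have hAan : AnalyticAt ℂ A 0 :=
    (((ContinuousLinearMap.const ℂ (sphere (0 : ℂ) ρ)).comp
      (ContinuousLinearMap.inl ℂ E ℂ)).analyticAt 0).add analyticAt_const
  have hA0 : A 0 ∈ eball 0 R := by
    rw [mem_eball_zero_iff]
    refine lt_of_lt_of_le ?_ hrR
    rw [← ofReal_norm, ENNReal.ofReal_lt_ofReal_iff hr0]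
    refine lt_of_le_of_lt ((ContinuousMap.norm_le _ hρ.le).2 fun ζ => ?_) hρr
    simpa [A, ι] using hρ.le
  refine ⟨N ∘ A, (hN _ hA0).1.comp hAan, ?_⟩
  filter_upwards [hAan.continuousAt.preimage_mem_nhds (isOpen_eball.mem_nhds hA0),
    ball_mem_nhds 0 hr0] with z hz hz'
  refine ⟨fun ζ => ?_, fun t ht => ?_⟩
  · exact ((hN _ hz).2 ζ).trans (by simp [A, ι])
  · have : (z, t) ∈ eball (0 : E × ℂ) R := by
      rw [mem_eball_zero_iff]
      refine lt_of_lt_of_le ?_ hrR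
      rw [← ofReal_norm, ENNReal.ofReal_lt_ofReal_iff hr0]
      simp at ht hz'
      simp [hz', ht.trans_lt hρr]
    have h := (hp.analyticAt_of_mem this).differentiableAt
    exact h.comp t (by fun_prop : DifferentiableAt ℂ (fun t => (z, t)) t)

/-- Normalized integration over a circle. -/
def circleAvg (ρ : ℝ) (hρ : 0 ≤ ρ) : C(Metric.sphere (0 : ℂ) ρ, ℂ) →L[ℂ] ℂ :=
  LinearMap.mkContinuous
    { toFun := fun φ => (2 * Real.pi * Complex.I : ℂ)⁻¹ •
        ∫ θ in (0 : ℝ)..2 * Real.pi, deriv (circleMap 0 ρ) θ •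
          φ ⟨circleMap 0 ρ θ, circleMap_mem_sphere 0 hρ θ⟩
      map_add' := by
        intro φ ψ
        rw [← smul_add, ← intervalIntegral.integral_add]
        · simp [mul_add]
        all_goals
          apply Continuous.intervalIntegrable
          simp only [deriv_circleMap]
          fun_prop
      map_smul' := by
        intro c φ
        simp only [RingHom.id_apply]
        rw [smul_comm c, ← intervalIntegral.integral_smul c]
        congr 2 with θ
        simp only [ContinuousMap.smul_apply, smul_comm c] }
    ρ (by
      intro φ
      simp only [LinearMap.coe_mk, AddHom.coe_mk]
      have := intervalIntegral.norm_integral_le_of_norm_le_const (a := 0) (b := 2 * Real.pi)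
        (C := ρ * ‖φ‖) (f := fun θ => deriv (circleMap 0 ρ) θ •
          φ ⟨circleMap 0 ρ θ, circleMap_mem_sphere 0 hρ θ⟩) (by
          intro θ _
          rw [norm_smul]
          gcongr
          · simp [abs_of_nonneg hρ]
          · exact φ.norm_coe_le_norm _)
      rw [norm_smul]
      have hpi := Real.pi_pos
      calc _ ≤ ‖(2 * Real.pi * Complex.I : ℂ)⁻¹‖ * (ρ * ‖φ‖ * |2 * Real.pi - 0|) := by gcongr
        _ = ρ * ‖φ‖ := by
          simp [abs_of_pos hpi]
          field_simp)

theorem circleAvg_eq {ρ : ℝ} (hρ : 0 ≤ ρ) (φ : C(Metric.sphere (0 : ℂ) ρ, ℂ)) (u : ℂ → ℂ)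
    (h : ∀ ζ, φ ζ = u ζ) :
    circleAvg ρ hρ φ = (2 * Real.pi * Complex.I : ℂ)⁻¹ • ∮ ζ in C(0, ρ), u ζ := by
  simp [circleAvg, circleIntegral, h]

end Weierstrass

section Weierstrass

/-- The monic polynomial `t ^ b + ∑ j < b, a j * t ^ j` evaluated in an algebra. -/
def monicEval {b : ℕ} {A : Type*} [CommRing A] [Algebra ℂ A] (a : Fin b → ℂ) (t : A) : A :=
  t ^ b + ∑ j, a j • t ^ (j : ℕ)

/-- The coefficient of `y ^ j` in `(monicEval a x - monicEval a y) / (x - y)`. -/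
def monicDivDiff {b : ℕ} {A : Type*} [CommRing A] [Algebra ℂ A] (a : Fin b → ℂ) (x : A)
    (j : Fin b) : A :=
  (if (j : ℕ) < b then x ^ (b - 1 - j) else 0) +
    ∑ i : Fin b, a i • if (j : ℕ) < i then x ^ (i - 1 - j : ℕ) else 0

theorem sub_mul_sum_ite_pow {A : Type*} [CommRing A] (x y : A) {i b : ℕ} (hi : i ≤ b) :
    (x - y) * ∑ j : Fin b, y ^ (j : ℕ) * (if (j : ℕ) < i then x ^ (i - 1 - j) else 0)
      = x ^ i - y ^ i := by
  rw [Fin.sum_univ_eq_sum_range (fun j => y ^ j * (if j < i then x ^ (i - 1 - j) else 0)) b]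
  have h1 : ∑ j ∈ Finset.range b, y ^ j * (if j < i then x ^ (i - 1 - j) else 0)
      = ∑ j ∈ Finset.range i, y ^ j * x ^ (i - 1 - j) := by
    symm
    rw [← Finset.sum_subset (Finset.range_mono hi)]
    · refine Finset.sum_congr rfl fun j hj => ?_
      rw [if_pos (Finset.mem_range.1 hj)]
    · intro j _ hj
      rw [if_neg (by simpa using hj), mul_zero]
  have h2 := (Commute.all y x).mul_geom_sum₂ i
  rw [h1]
  linear_combination -h2

theorem monicEval_sub_monicEval {b : ℕ} {A : Type*} [CommRing A] [Algebra ℂ A]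
    (a : Fin b → ℂ) (x y : A) :
    monicEval a x - monicEval a y = (x - y) * ∑ j : Fin b, y ^ (j : ℕ) * monicDivDiff a x j := by
  have h : ∑ j : Fin b, y ^ (j : ℕ) * monicDivDiff a x j
      = ∑ j : Fin b, y ^ (j : ℕ) * (if (j : ℕ) < b then x ^ (b - 1 - j) else 0)
        + ∑ i : Fin b, a i • ∑ j : Fin b,
          y ^ (j : ℕ) * (if (j : ℕ) < i then x ^ (i - 1 - j : ℕ) else 0) := by
    simp only [monicDivDiff, mul_add, Finset.mul_sum, Finset.sum_add_distrib, Finset.smul_sum,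
      mul_smul_comm]
    rw [Finset.sum_comm (s := Finset.univ (α := Fin b))]
  rw [h, mul_add, sub_mul_sum_ite_pow x y le_rfl, Finset.mul_sum]
  simp only [mul_smul_comm]
  rw [Finset.sum_congr rfl fun i _ => by rw [sub_mul_sum_ite_pow x y (Fin.is_lt i).le]]
  simp only [monicEval, smul_sub, Finset.sum_sub_distrib]
  ring

theorem analyticAt_monicEval {b : ℕ} {A : Type*} [NormedCommRing A] [NormedAlgebra ℂ A]
    {V : Type*} [NormedAddCommGroup V] [NormedSpace ℂ V] {a : V → Fin b → ℂ} {t : V → A} {v : V}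
    (ha : AnalyticAt ℂ a v) (ht : AnalyticAt ℂ t v) :
    AnalyticAt ℂ (fun v => monicEval (a v) (t v)) v := by
  unfold monicEval
  have ha' : ∀ i, AnalyticAt ℂ (fun v => a v i) v := analyticAt_pi_iff.1 ha
  fun_prop

theorem analyticAt_monicDivDiff {b : ℕ} {A : Type*} [NormedCommRing A] [NormedAlgebra ℂ A]
    {V : Type*} [NormedAddCommGroup V] [NormedSpace ℂ V] {a : V → Fin b → ℂ} {v : V}
    (ha : AnalyticAt ℂ a v) (x : A) (j : Fin b) :
    AnalyticAt ℂ (fun v => monicDivDiff (a v) x j) v := by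
  unfold monicDivDiff
  have ha' : ∀ i, AnalyticAt ℂ (fun v => a v i) v := analyticAt_pi_iff.1 ha
  fun_prop

theorem analyticAt_ringInverse {A : Type*} [NormedRing A] [NormedAlgebra ℂ A]
    [HasSummableGeomSeries A] {V : Type*} [NormedAddCommGroup V] [NormedSpace ℂ V] {f : V → A}
    {v : V} (hf : AnalyticAt ℂ f v) (hu : IsUnit (f v)) :
    AnalyticAt ℂ (fun v => Ring.inverse (f v)) v := by
  obtain ⟨u, hu⟩ := hu
  exact AnalyticAt.comp (g := Ring.inverse) (f := f) (hu ▸ analyticAt_inverse u) hf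

variable {E : Type*} [NormedAddCommGroup E] [NormedSpace ℂ E]

open Metric in
/-- Division by the universal monic polynomial of degree `b`. -/
theorem exists_universal_division {G : E × ℂ → ℂ} (hG : AnalyticAt ℂ G 0) (b : ℕ) :
    ∃ (Q : (E × (Fin b → ℂ)) × ℂ → ℂ) (R : E × (Fin b → ℂ) → Fin b → ℂ),
      AnalyticAt ℂ Q 0 ∧ AnalyticAt ℂ R 0 ∧
      ∀ᶠ x in 𝓝 (0 : (E × (Fin b → ℂ)) × ℂ),
        G (x.1.1, x.2) = monicEval x.1.2 x.2 * Q x + ∑ j, R x.1 j * x.2 ^ (j : ℕ) := by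
  obtain ⟨r, hr, H⟩ := exists_restrict_sphere hG
  obtain ⟨ρ, hρ, hρr⟩ : ∃ ρ, 0 < ρ ∧ ρ < r := ⟨r / 2, half_pos hr, half_lt_self hr⟩
  obtain ⟨Fh, hFh, hev⟩ := H ρ hρ hρr
  let A := C(sphere (0 : ℂ) ρ, ℂ)
  let ι : A := ⟨fun ζ => ζ, by fun_prop⟩
  let Λ : A →L[ℂ] ℂ := circleAvg ρ hρ.le
  have hιu : IsUnit ι := by
    rw [ContinuousMap.isUnit_iff_forall_ne_zero]
    rintro ⟨x, hx⟩ h0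
    have : x = 0 := h0
    simp [this, hρ.ne] at hx
  have hanP : AnalyticAt ℂ (fun a : Fin b → ℂ => monicEval a ι) 0 :=
    analyticAt_monicEval analyticAt_id analyticAt_const
  have hP0 : IsUnit (monicEval (0 : Fin b → ℂ) ι) := by
    simpa [monicEval] using hιu.pow b
  have hinvP : AnalyticAt ℂ (fun a : Fin b → ℂ => Ring.inverse (monicEval a ι)) 0 :=
    analyticAt_ringInverse hanP hP0
  have hanι : AnalyticAt ℂ (fun t : ℂ => ι - algebraMap ℂ A t) 0 :=
    analyticAt_const.sub ((Algebra.linearMap ℂ A).toContinuousLinearMap.analyticAt 0)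
  have hι0 : IsUnit (ι - algebraMap ℂ A 0) := by simpa using hιu
  have hinvι : AnalyticAt ℂ (fun t : ℂ => Ring.inverse (ι - algebraMap ℂ A t)) 0 :=
    analyticAt_ringInverse hanι hι0
  have hmain : AnalyticAt ℂ (fun w : E × (Fin b → ℂ) =>
      Fh w.1 * Ring.inverse (monicEval w.2 ι)) 0 :=
    (AnalyticAt.comp (g := Fh) (f := Prod.fst) (x := (0 : E × (Fin b → ℂ))) hFh
      analyticAt_fst).mul
      (AnalyticAt.comp (f := Prod.snd) (x := (0 : E × (Fin b → ℂ))) hinvP analyticAt_snd)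
  refine ⟨fun x => Λ (Fh x.1.1 * Ring.inverse (monicEval x.1.2 ι) *
      Ring.inverse (ι - algebraMap ℂ A x.2)),
    fun w j => Λ (Fh w.1 * Ring.inverse (monicEval w.2 ι) * monicDivDiff w.2 ι j), ?_, ?_, ?_⟩
  · refine (Λ.analyticAt _).comp ?_
    exact (AnalyticAt.comp (f := Prod.fst) (x := (0 : (E × (Fin b → ℂ)) × ℂ)) hmain
      analyticAt_fst).mul
      (AnalyticAt.comp (f := Prod.snd) (x := (0 : (E × (Fin b → ℂ)) × ℂ)) hinvι analyticAt_snd)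
  · rw [analyticAt_pi_iff]
    intro j
    refine (Λ.analyticAt _).comp (hmain.mul ?_)
    exact analyticAt_monicDivDiff analyticAt_snd ι j
  · have e1 : ∀ᶠ a in 𝓝 (0 : Fin b → ℂ), IsUnit (monicEval a ι) :=
      hanP.continuousAt.eventually (Units.isOpen.mem_nhds hP0)
    have e2 : ∀ᶠ t in 𝓝 (0 : ℂ), IsUnit (ι - algebraMap ℂ A t) :=
      hanι.continuousAt.eventually (Units.isOpen.mem_nhds hι0)
    have c1 : Tendsto (fun x : (E × (Fin b → ℂ)) × ℂ => x.1.2) (𝓝 0) (𝓝 0) :=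
      Continuous.tendsto' (by fun_prop) _ _ rfl
    have c2 : Tendsto (fun x : (E × (Fin b → ℂ)) × ℂ => x.2) (𝓝 0) (𝓝 0) :=
      Continuous.tendsto' (by fun_prop) _ _ rfl
    have c3 : Tendsto (fun x : (E × (Fin b → ℂ)) × ℂ => x.1.1) (𝓝 0) (𝓝 0) :=
      Continuous.tendsto' (by fun_prop) _ _ rfl
    filter_upwards [c1.eventually e1, c2.eventually e2, c3.eventually hev,
      c2.eventually (ball_mem_nhds 0 hρ)] with x h1 h2 h3 h4
    obtain ⟨⟨z, a⟩, t⟩ := x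
    simp only at h1 h2 h3 h4 ⊢
    have hu := Ring.inverse_mul_cancel _ h1
    have hv := Ring.inverse_mul_cancel _ h2
    have hdd := monicEval_sub_monicEval a ι (algebraMap ℂ A t)
    have halg : monicEval a (algebraMap ℂ A t) = algebraMap ℂ A (monicEval a t) := by
      simp [monicEval, Algebra.smul_def]
    have key : Fh z * Ring.inverse (ι - algebraMap ℂ A t)
        = monicEval a t • (Fh z * Ring.inverse (monicEval a ι) *
            Ring.inverse (ι - algebraMap ℂ A t))
          + ∑ j : Fin b, t ^ (j : ℕ) • (Fh z * Ring.inverse (monicEval a ι) * monicDivDiff a ι j) := by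
      have hs : ∑ j : Fin b, t ^ (j : ℕ) • (Fh z * Ring.inverse (monicEval a ι) * monicDivDiff a ι j)
          = Fh z * Ring.inverse (monicEval a ι) *
            ∑ j : Fin b, algebraMap ℂ A t ^ (j : ℕ) * monicDivDiff a ι j := by
        rw [Finset.mul_sum]
        refine Finset.sum_congr rfl fun j _ => ?_
        rw [Algebra.smul_def, map_pow]; ring
      rw [hs, Algebra.smul_def, ← halg]
      linear_combination (-Fh z * Ring.inverse (ι - algebraMap ℂ A t)) * hu
        + (Fh z * Ring.inverse (monicEval a ι) * Ring.inverse (ι - algebraMap ℂ A t)) * hdd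
        + (Fh z * Ring.inverse (monicEval a ι) *
          ∑ j : Fin b, algebraMap ℂ A t ^ (j : ℕ) * monicDivDiff a ι j) * hv
    have hcauchy : Λ (Fh z * Ring.inverse (ι - algebraMap ℂ A t)) = G (z, t) := by
      rw [show Λ = circleAvg ρ hρ.le from rfl, circleAvg_eq hρ.le _
        (fun ζ => (ζ - t)⁻¹ • G (z, ζ))]
      · exact Complex.two_pi_I_inv_smul_circleIntegral_sub_inv_smul_of_differentiable_on_off_countable
          (f := fun t => G (z, t)) Set.countable_empty h4
          (fun t ht => (h3.2 t ht).continuousAt.continuousWithinAt)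
          (fun t ht => h3.2 t (ball_subset_closedBall ht.1))
      · intro ζ
        have hv' := congrArg (fun φ : A => φ ζ) hv
        change Ring.inverse (ι - algebraMap ℂ A t) ζ * (ζ - t) = 1 at hv'
        rw [ContinuousMap.mul_apply, h3.1, eq_inv_of_mul_eq_one_left hv', mul_comm]
        rfl
    rw [← hcauchy, key, map_add, map_smul, map_sum]
    simp only [map_smul, smul_eq_mul]
    congr 1
    exact Finset.sum_congr rfl fun j _ => mul_comm _ _

end Weierstrass

section Weierstrass

/-- A polynomial of degree less than `b` that is `O(t ^ b)` vanishes. -/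
theorem coeff_eq_zero_of_eventually_eq_pow_mul {b : ℕ} {c : Fin b → ℂ} {v : ℂ → ℂ}
    (hv : ContinuousAt v 0)
    (h : ∀ᶠ t in 𝓝 (0 : ℂ), ∑ j, c j * t ^ (j : ℕ) = t ^ b * v t) : c = 0 := by
  classical
  let P : Polynomial ℂ := ∑ j : Fin b, Polynomial.monomial (j : ℕ) (c j)
  have hPe : ∀ t, P.eval t = ∑ j, c j * t ^ (j : ℕ) := by
    intro t; simp [P, Polynomial.eval_finsetSum]
  have hPdeg : P.degree < b := by
    refine (Polynomial.degree_sum_le _ _).trans_lt ?_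
    refine (Finset.sup_lt_iff (WithBot.bot_lt_coe b)).2 fun j _ => ?_
    exact (Polynomial.degree_monomial_le _ _).trans_lt (WithBot.coe_lt_coe.2 j.2)
  have hcoef : ∀ j : Fin b, P.coeff j = c j := by
    intro j
    simp [P, Polynomial.coeff_monomial, Fin.val_inj]
  by_cases hP : P = 0
  · ext j; rw [← hcoef, hP]; simp
  exfalso
  obtain ⟨q, hq, hq0⟩ := P.exists_eq_pow_rootMultiplicity_mul_and_not_dvd hP 0
  set k := P.rootMultiplicity 0
  have hk : k < b := by
    have h1 : k ≤ P.natDegree := by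
      rw [show k = P.roots.count 0 from P.count_roots.symm]
      exact (Multiset.count_le_card _ _).trans P.card_roots'
    exact h1.trans_lt ((Polynomial.natDegree_lt_iff_degree_lt hP).2 hPdeg)
  have hq1 : q.eval 0 ≠ 0 := fun h0 => hq0 (Polynomial.dvd_iff_isRoot.2 h0)
  have e1 : ∀ᶠ t in 𝓝[≠] (0 : ℂ), q.eval t = t ^ (b - k) * v t := by
    filter_upwards [h.filter_mono nhdsWithin_le_nhds, self_mem_nhdsWithin] with t ht ht0
    have ht0' : t ≠ 0 := ht0
    rw [← hPe, hq] at ht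
    have hsplit : t ^ b = t ^ k * t ^ (b - k) := by rw [← pow_add]; congr 1; omega
    rw [hsplit, mul_assoc] at ht
    simp only [map_zero, sub_zero, Polynomial.eval_mul, Polynomial.eval_pow,
      Polynomial.eval_X] at ht
    exact mul_left_cancel₀ (pow_ne_zero _ ht0') ht
  have l1 : Tendsto (fun t => q.eval t) (𝓝[≠] (0 : ℂ)) (𝓝 (q.eval 0)) :=
    (q.continuous.tendsto 0).mono_left nhdsWithin_le_nhds
  have l2 : Tendsto (fun t => t ^ (b - k) * v t) (𝓝[≠] (0 : ℂ)) (𝓝 0) := by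
    have : Tendsto (fun t => t ^ (b - k) * v t) (𝓝 (0 : ℂ)) (𝓝 (0 ^ (b - k) * v 0)) :=
      ((continuous_pow (b - k)).tendsto 0).mul hv
    rw [zero_pow (by omega), zero_mul] at this
    exact this.mono_left nhdsWithin_le_nhds
  exact hq1 (tendsto_nhds_unique (l1.congr' e1) l2)

variable {E : Type*} [NormedAddCommGroup E] [NormedSpace ℂ E] [CompleteSpace E]

/-- The Weierstrass preparation and division theorems. -/
theorem weierstrass {f : E × ℂ → ℂ} (hf : AnalyticAt ℂ f 0) {b : ℕ} {u : ℂ → ℂ}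
    (hu : ContinuousAt u 0) (hu0 : u 0 ≠ 0) (hfu : ∀ᶠ t in 𝓝 (0 : ℂ), f (0, t) = t ^ b * u t) :
    ∃ a : E → Fin b → ℂ, AnalyticAt ℂ a 0 ∧ a 0 = 0 ∧
      (∃ e : E × ℂ → ℂ, AnalyticAt ℂ e 0 ∧ e 0 ≠ 0 ∧
        ∀ᶠ x in 𝓝 (0 : E × ℂ), f x = monicEval (a x.1) x.2 * e x) ∧
      ∀ G : E × ℂ → ℂ, AnalyticAt ℂ G 0 → ∃ (q : E × ℂ → ℂ) (r : E → Fin b → ℂ),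
        AnalyticAt ℂ q 0 ∧ AnalyticAt ℂ r 0 ∧
        ∀ᶠ x in 𝓝 (0 : E × ℂ),
          G x = monicEval (a x.1) x.2 * q x + ∑ j, r x.1 j * x.2 ^ (j : ℕ) := by
  obtain ⟨Q, R, hQ, hR, hQR⟩ := exists_universal_division hf b
  have cT : Tendsto (fun t : ℂ => ((0 : E × (Fin b → ℂ)), t)) (𝓝 0) (𝓝 0) :=
    Continuous.tendsto' (by fun_prop) _ _ rfl
  have hQt : ContinuousAt (fun t : ℂ => Q (0, t)) 0 :=
    ContinuousAt.comp (g := Q) (f := fun t : ℂ => ((0 : E × (Fin b → ℂ)), t)) hQ.continuousAt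
      (by fun_prop)
  have hR0 : R 0 = 0 := by
    refine coeff_eq_zero_of_eventually_eq_pow_mul (v := fun t => u t - Q (0, t)) (hu.sub hQt) ?_
    filter_upwards [cT.eventually hQR, hfu] with t h1 h2
    simp only [Prod.fst_zero, Prod.snd_zero] at h1
    simp only [h2, monicEval, Pi.zero_apply, zero_smul, Finset.sum_const_zero, add_zero] at h1
    linear_combination -h1
  have hQ0 : Q 0 ≠ 0 := by
    have e1 : ∀ᶠ t in 𝓝[≠] (0 : ℂ), u t = Q (0, t) := by
      filter_upwards [(cT.eventually hQR).filter_mono nhdsWithin_le_nhds,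
        hfu.filter_mono nhdsWithin_le_nhds, self_mem_nhdsWithin] with t h1 h2 h3
      simp only [Prod.fst_zero, Prod.snd_zero] at h1
      simp only [h2, hR0, monicEval, Pi.zero_apply, zero_smul, Finset.sum_const_zero, add_zero,
        zero_mul] at h1
      exact mul_left_cancel₀ (pow_ne_zero _ h3) h1
    have l1 : Tendsto u (𝓝[≠] (0 : ℂ)) (𝓝 (u 0)) := hu.tendsto.mono_left nhdsWithin_le_nhds
    have l2 := hQt.tendsto.mono_left (nhdsWithin_le_nhds (s := {(0 : ℂ)}ᶜ))
    rw [← Prod.mk_zero_zero, ← tendsto_nhds_unique (l1.congr' e1) l2]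
    exact hu0
  have hinj : Function.Injective
      (fderiv ℂ R 0 ∘SL ContinuousLinearMap.inr ℂ E (Fin b → ℂ)) := by
    rw [injective_iff_map_eq_zero]
    intro da hda
    let D : ℂ → ℂ := fun t => fderiv ℂ Q (0, t) ((0, da), 0)
    have hD : ContinuousAt D 0 := by
      have h1 : ContinuousAt (fun t : ℂ => fderiv ℂ Q (0, t)) 0 :=
        ContinuousAt.comp (g := fderiv ℂ Q) (f := fun t : ℂ => ((0 : E × (Fin b → ℂ)), t))
          hQ.fderiv.continuousAt (by fun_prop)
      exact h1.clm_apply continuousAt_const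
    refine coeff_eq_zero_of_eventually_eq_pow_mul (v := fun t => -D t / Q (0, t))
      (hD.neg.div hQt hQ0) ?_
    filter_upwards [cT.eventually (eventually_eventually_nhds.2 hQR),
      cT.eventually hQ.eventually_analyticAt, hQt.eventually_ne hQ0] with t h1 h2 h3
    have hline : Tendsto (fun s : ℂ => (((0 : E), s • da), t)) (𝓝 0)
        (𝓝 ((0 : E × (Fin b → ℂ)), t)) :=
      Continuous.tendsto' (by fun_prop) _ _ (by simp)
    have h4 := hline.eventually h1
    have dline : HasDerivAt (fun s : ℂ => (((0 : E), s • da), t)) ((0, da), 0) 0 := by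
      have h := ((hasDerivAt_const (0 : ℂ) (0 : E)).prodMk
        ((hasDerivAt_id (0 : ℂ)).smul_const da)).prodMk (hasDerivAt_const (0 : ℂ) t)
      simpa using h
    have dline' : HasDerivAt (fun s : ℂ => ((0 : E), s • da)) (0, da) 0 := by
      have h := ((hasDerivAt_const (0 : ℂ) (0 : E)).prodMk
        ((hasDerivAt_id (0 : ℂ)).smul_const da))
      simpa using h
    have dQ : HasDerivAt (fun s : ℂ => Q ((0, s • da), t)) (D t) 0 := by
      have h5 : HasFDerivAt Q (fderiv ℂ Q (0, t)) ((0, (0 : ℂ) • da), t) := by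
        rw [zero_smul]; exact h2.differentiableAt.hasFDerivAt
      exact h5.comp_hasDerivAt (0 : ℂ) dline
    have dR : HasDerivAt (fun s : ℂ => R (0, s • da)) 0 0 := by
      have h5 : HasFDerivAt R (fderiv ℂ R 0) (0, (0 : ℂ) • da) := by
        rw [zero_smul]; exact hR.differentiableAt.hasFDerivAt
      have h6 := h5.comp_hasDerivAt (0 : ℂ) dline'
      have h7 : fderiv ℂ R 0 (0, da) = 0 := hda
      rwa [h7] at h6
    have dR' : ∀ j, HasDerivAt (fun s : ℂ => R (0, s • da) j) 0 0 := by
      intro j; exact (hasDerivAt_pi.1 dR) j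
    have dP : HasDerivAt (fun s : ℂ => monicEval (s • da) t) (∑ j, da j * t ^ (j : ℕ)) 0 := by
      have : (fun s : ℂ => monicEval (s • da) t)
          = fun s => t ^ b + s * ∑ j, da j * t ^ (j : ℕ) := by
        ext s; simp [monicEval, Finset.mul_sum, mul_assoc]
      rw [this]
      simpa using ((hasDerivAt_id (0 : ℂ)).mul_const (∑ j, da j * t ^ (j : ℕ))).const_add (t ^ b)
    have dtot := (dP.mul dQ).add
      (HasDerivAt.fun_sum fun j (_ : j ∈ Finset.univ) => (dR' j).mul_const (t ^ (j : ℕ)))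
    have d0 : HasDerivAt (fun _ : ℂ => f (0, t)) 0 0 := hasDerivAt_const _ _
    have heq := (d0.congr_of_eventuallyEq (EventuallyEq.symm h4)).unique dtot
    have hm0 : monicEval ((0 : ℂ) • da) t = t ^ b := by simp [monicEval]
    rw [hm0, zero_smul] at heq
    simp only [zero_mul, Finset.sum_const_zero, add_zero] at heq
    change 0 = (∑ j, da j * t ^ (j : ℕ)) * Q (0, t) + t ^ b * D t at heq
    field_simp
    linear_combination -heq
  have hinv : (fderiv ℂ R 0 ∘SL ContinuousLinearMap.inr ℂ E (Fin b → ℂ)).IsInvertible := by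
    refine ⟨(LinearEquiv.ofInjectiveEndo _ hinj).toContinuousLinearEquiv, ?_⟩
    ext x; rfl
  have hRc : ContDiffAt ℂ ⊤ R (0 : E × (Fin b → ℂ)) := hR.contDiffAt
  have htop : (⊤ : WithTop ℕ∞) ≠ 0 := by simp
  let a := hRc.implicitFunction htop hinv
  have ha0 : a 0 = 0 := hRc.implicitFunction_apply_self htop hinv
  have haR : ∀ᶠ z in 𝓝 (0 : E), R (z, a z) = 0 := by
    have := hRc.eventually_apply_implicitFunction htop hinv
    rw [hR0] at this
    exact this
  have ha : AnalyticAt ℂ a 0 :=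
    (hRc.contDiffAt_implicitFunction htop hinv).analyticAt
  let Ψ : E × ℂ → (E × (Fin b → ℂ)) × ℂ := fun x => ((x.1, a x.1), x.2)
  have hΨ0 : Ψ 0 = 0 := by simp [Ψ, ha0]
  have hΨ' : AnalyticAt ℂ (fun z => (z, a z)) 0 := analyticAt_id.prod ha
  have hΨ : AnalyticAt ℂ Ψ 0 :=
    (AnalyticAt.comp (f := Prod.fst) (x := (0 : E × ℂ)) hΨ' analyticAt_fst).prod analyticAt_snd
  have hΨt : Tendsto Ψ (𝓝 0) (𝓝 0) := by simpa [hΨ0] using hΨ.continuousAt.tendsto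
  have hfst : Tendsto (Prod.fst : E × ℂ → E) (𝓝 0) (𝓝 0) :=
    Continuous.tendsto' (by fun_prop) _ _ rfl
  refine ⟨a, ha, ha0, ⟨Q ∘ Ψ, AnalyticAt.comp (by rwa [hΨ0]) hΨ, ?_, ?_⟩, ?_⟩
  · simpa [hΨ0] using hQ0
  · filter_upwards [hΨt.eventually hQR, hfst.eventually haR] with x h1 h2
    simp only [Ψ, h2] at h1
    simpa using h1
  · intro G hG
    obtain ⟨Q', R', hQ', hR', h'⟩ := exists_universal_division hG b
    refine ⟨Q' ∘ Ψ, fun z => R' (z, a z), AnalyticAt.comp (by rwa [hΨ0]) hΨ,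
      AnalyticAt.comp (g := R') (f := fun z => (z, a z)) (by rw [ha0]; exact hR') hΨ', ?_⟩
    filter_upwards [hΨt.eventually h'] with x h1
    exact h1

end Weierstrass

section AnalyticGerms

variable (E : Type*) [NormedAddCommGroup E] [NormedSpace ℂ E]

/-- The ring of germs at `0` of analytic functions on a normed space. -/
def analyticGerms : Subalgebra ℂ (Filter.Germ (𝓝 (0 : E)) ℂ) where
  carrier := {φ | ∃ f : E → ℂ, AnalyticAt ℂ f 0 ∧ φ = ↑f}
  mul_mem' := by
    rintro a b ⟨f, hf, rfl⟩ ⟨g, hg, rfl⟩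
    exact ⟨f * g, hf.mul hg, rfl⟩
  one_mem' := ⟨1, analyticAt_const, rfl⟩
  add_mem' := by
    rintro a b ⟨f, hf, rfl⟩ ⟨g, hg, rfl⟩
    exact ⟨f + g, hf.add hg, rfl⟩
  zero_mem' := ⟨0, analyticAt_const, rfl⟩
  algebraMap_mem' := fun c => ⟨fun _ => c, analyticAt_const, rfl⟩

variable {E} {F : Type*} [NormedAddCommGroup F] [NormedSpace ℂ F]

/-- The germ of an analytic function. -/
def mkGerm (f : E → ℂ) (hf : AnalyticAt ℂ f 0) : analyticGerms E := ⟨↑f, f, hf, rfl⟩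

theorem exists_mkGerm (x : analyticGerms E) : ∃ f hf, x = mkGerm f hf := by
  obtain ⟨x, f, hf, rfl⟩ := x
  exact ⟨f, hf, rfl⟩

theorem mkGerm_eq_iff {f g : E → ℂ} {hf : AnalyticAt ℂ f 0} {hg : AnalyticAt ℂ g 0} :
    mkGerm f hf = mkGerm g hg ↔ f =ᶠ[𝓝 0] g :=
  Subtype.ext_iff.trans Filter.Germ.coe_eq

theorem mkGerm_eq_zero_iff {f : E → ℂ} {hf : AnalyticAt ℂ f 0} :
    mkGerm f hf = 0 ↔ ∀ᶠ z in 𝓝 0, f z = 0 :=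
  mkGerm_eq_iff (hg := analyticAt_const)

/-- Evaluation of germs at the origin. -/
def germEval : analyticGerms E →+* ℂ :=
  (Filter.Germ.valueRingHom (X := E) (E := ℂ) (x := 0)).comp (analyticGerms E).val.toRingHom

@[simp] theorem germEval_mkGerm (f : E → ℂ) (hf : AnalyticAt ℂ f 0) :
    germEval (mkGerm f hf) = f 0 := rfl

theorem isUnit_iff_germEval_ne_zero {x : analyticGerms E} : IsUnit x ↔ germEval x ≠ 0 := by
  refine ⟨fun h => (h.map germEval).ne_zero, fun h => ?_⟩
  obtain ⟨f, hf, rfl⟩ := exists_mkGerm x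
  refine IsUnit.of_mul_eq_one (mkGerm f⁻¹ (hf.inv h)) ?_
  change mkGerm (f * f⁻¹) (hf.mul (hf.inv h)) = mkGerm 1 analyticAt_const
  rw [mkGerm_eq_iff]
  filter_upwards [hf.continuousAt.eventually_ne h] with z hz
  simp [hz]

instance : IsLocalHom (germEval (E := E)) :=
  ⟨fun _ h => isUnit_iff_germEval_ne_zero.2 h.ne_zero⟩

instance : IsLocalRing (analyticGerms E) := RingHom.domain_isLocalRing germEval

theorem mem_maximalIdeal_iff_germEval {x : analyticGerms E} :
    x ∈ IsLocalRing.maximalIdeal (analyticGerms E) ↔ germEval x = 0 := by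
  rw [IsLocalRing.mem_maximalIdeal, mem_nonunits_iff, isUnit_iff_germEval_ne_zero, not_not]

/-- Pullback of germs along an analytic map preserving the origin. -/
def germComp (φ : E → F) (hφ : AnalyticAt ℂ φ 0) (h0 : φ 0 = 0) :
    analyticGerms F →ₐ[ℂ] analyticGerms E where
  toFun x := ⟨x.1.compTendsto φ (by simpa [ContinuousAt, h0] using hφ.continuousAt), by
    obtain ⟨x, f, hf, rfl⟩ := x
    exact ⟨f ∘ φ, AnalyticAt.comp (by rwa [h0]) hφ, rfl⟩⟩
  map_one' := rfl
  map_zero' := rfl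
  map_add' := by
    rintro ⟨x, f, hf, rfl⟩ ⟨y, g, hg, rfl⟩
    rfl
  map_mul' := by
    rintro ⟨x, f, hf, rfl⟩ ⟨y, g, hg, rfl⟩
    rfl
  commutes' _ := rfl

theorem germComp_mkGerm (φ : E → F) (hφ : AnalyticAt ℂ φ 0) (h0 : φ 0 = 0) (f : F → ℂ)
    (hf : AnalyticAt ℂ f 0) :
    germComp φ hφ h0 (mkGerm f hf) = mkGerm (f ∘ φ) (AnalyticAt.comp (by rwa [h0]) hφ) := rfl

/-- Linear changes of coordinates act on germs. -/
def germEquiv (L : E ≃L[ℂ] F) : analyticGerms F ≃ₐ[ℂ] analyticGerms E :=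
  AlgEquiv.ofAlgHom (germComp L (L.analyticAt 0) (map_zero L))
    (germComp L.symm (L.symm.analyticAt 0) (map_zero L.symm))
    (by
      ext x
      obtain ⟨f, hf, rfl⟩ := exists_mkGerm x
      simp [germComp_mkGerm, Function.comp_assoc])
    (by
      ext x
      obtain ⟨f, hf, rfl⟩ := exists_mkGerm x
      simp [germComp_mkGerm, Function.comp_assoc])

/-- A nonzero vector is the last basis vector of some linear coordinate system. -/
theorem exists_clm_equiv_apply_eq {n : ℕ} {v : Fin (n + 1) → ℂ} (hv : v ≠ 0) :
    ∃ L : ((Fin n → ℂ) × ℂ) ≃L[ℂ] (Fin (n + 1) → ℂ), ∀ t, L (0, t) = t • v := by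
  obtain ⟨W, hW⟩ := Submodule.exists_isCompl (ℂ ∙ v)
  have h1 : Module.finrank ℂ (ℂ ∙ v) = 1 := finrank_span_singleton hv
  have h2 : Module.finrank ℂ W = n := by
    have := Submodule.finrank_add_eq_of_isCompl hW
    simp [h1] at this
    omega
  let e1 : (Fin n → ℂ) ≃ₗ[ℂ] W := LinearEquiv.ofFinrankEq _ _ (by simp [h2])
  let e2 : ℂ ≃ₗ[ℂ] (ℂ ∙ v) := LinearEquiv.toSpanNonzeroSingleton ℂ _ v hv
  let e := (e1.prodCongr e2).trans (Submodule.prodEquivOfIsCompl W (ℂ ∙ v) hW.symm)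
  refine ⟨e.toContinuousLinearEquiv, fun t => ?_⟩
  simp [e, e2]

/-- After a linear change of coordinates, a nonzero germ is regular in the last variable. -/
theorem exists_regular_coordinates {n : ℕ} {f : (Fin (n + 1) → ℂ) → ℂ} (hf : AnalyticAt ℂ f 0)
    (hf0 : ¬ ∀ᶠ z in 𝓝 0, f z = 0) :
    ∃ (L : ((Fin n → ℂ) × ℂ) ≃L[ℂ] (Fin (n + 1) → ℂ)) (b : ℕ) (u : ℂ → ℂ), AnalyticAt ℂ u 0 ∧
      u 0 ≠ 0 ∧ ∀ᶠ t in 𝓝 (0 : ℂ), f (L (0, t)) = t ^ b * u t := by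
  have key : ∃ v : Fin (n + 1) → ℂ, v ≠ 0 ∧ ¬ ∀ᶠ t : ℂ in 𝓝 0, f (t • v) = 0 := by
    by_cases h0 : f 0 = 0
    · by_contra! hcon
      apply hf0
      obtain ⟨r, hr, hball⟩ := Metric.eventually_nhds_iff_ball.1 hf.eventually_analyticAt
      filter_upwards [Metric.ball_mem_nhds 0 hr] with v hv
      rcases eq_or_ne v 0 with rfl | hv0
      · exact h0
      have hvr : ‖v‖ < r := by simpa using hv
      have hvp : 0 < ‖v‖ := norm_pos_iff.2 hv0
      have han : AnalyticOnNhd ℂ (fun t : ℂ => f (t • v)) (Metric.ball 0 (r / ‖v‖)) := by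
        intro t ht
        refine AnalyticAt.comp (g := f) (f := fun t : ℂ => t • v) (hball _ ?_) (by fun_prop)
        rw [mem_ball_zero_iff, norm_smul]
        rw [mem_ball_zero_iff, lt_div_iff₀ hvp] at ht
        exact ht
      have := han.eqOn_zero_of_preconnected_of_eventuallyEq_zero
        (convex_ball _ _).isPreconnected (Metric.mem_ball_self (div_pos hr hvp)) (hcon v hv0)
      have h1 : (1 : ℂ) ∈ Metric.ball (0 : ℂ) (r / ‖v‖) := by
        simp [lt_div_iff₀ hvp, hvr]
      simpa using this h1
    · refine ⟨fun _ => 1, fun h => one_ne_zero (congrFun h 0), fun h => h0 ?_⟩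
      simpa using h.self_of_nhds
  obtain ⟨v, hv, hv'⟩ := key
  obtain ⟨L, hL⟩ := exists_clm_equiv_apply_eq hv
  have han : AnalyticAt ℂ (fun t : ℂ => f (t • v)) 0 :=
    AnalyticAt.comp (g := f) (f := fun t : ℂ => t • v) (by simpa using hf) (by fun_prop)
  obtain ⟨b, u, hu, hu0, hbu⟩ := han.exists_eventuallyEq_pow_smul_nonzero_iff.2 hv'
  refine ⟨L, b, u, hu, hu0, ?_⟩
  filter_upwards [hbu] with t ht
  rw [hL, ht]; simp

end AnalyticGerms

section AnalyticGerms

/-- An ideal of `B` is finitely generated if `B` modulo one of its elements is finite over a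
Noetherian ring. -/
theorem Ideal.fg_of_forall_exists_remainder {A B : Type*} [CommRing A] [CommRing B]
    [IsNoetherianRing A] (φ : A →+* B) {ι : Type*} [Fintype ι] (w : ι → B) {I : Ideal B}
    {P : B} (hP : P ∈ I) (h : ∀ g : B, ∃ (q : B) (r : ι → A), g = P * q + ∑ j, φ (r j) * w j) :
    I.FG := by
  let N : Submodule A (ι → A) :=
    { carrier := {r | ∑ j, φ (r j) * w j ∈ I}
      zero_mem' := by simp
      add_mem' := by
        intro a b ha hb
        simpa [add_mul, Finset.sum_add_distrib] using I.add_mem ha hb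
      smul_mem' := by
        intro c a ha
        simpa [mul_assoc, Finset.mul_sum] using I.mul_mem_left (φ c) ha }
  obtain ⟨s, hs⟩ : N.FG := IsNoetherian.noetherian N
  classical
  refine ⟨insert P (s.image fun r => ∑ j, φ (r j) * w j), le_antisymm ?_ ?_⟩
  · rw [Submodule.span_le]
    intro x hx
    simp only [Finset.coe_insert, Finset.coe_image, Set.mem_insert_iff, Set.mem_image] at hx
    rcases hx with rfl | ⟨r, hr, rfl⟩
    · exact hP
    · have : r ∈ N := hs ▸ Submodule.subset_span hr
      exact this
  · intro g hg
    obtain ⟨q, r, rfl⟩ := h g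
    refine Submodule.add_mem _ ?_ ?_
    · exact Ideal.mul_mem_right _ _ (Submodule.subset_span (by simp))
    · have hr : r ∈ N := (Submodule.add_mem_iff_right I (I.mul_mem_right q hP)).1 hg
      clear hg
      rw [← hs] at hr
      induction hr using Submodule.span_induction with
      | mem x hx => exact Submodule.subset_span (by
          simp only [Finset.coe_insert, Finset.coe_image, Set.mem_insert_iff, Set.mem_image]
          exact Or.inr ⟨x, hx, rfl⟩)
      | zero => simp
      | add x y _ _ hx hy =>
        simpa [add_mul, Finset.sum_add_distrib] using Submodule.add_mem _ hx hy
      | smul c x _ hx =>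
        simpa [mul_assoc, Finset.mul_sum] using Ideal.mul_mem_left _ (φ c) hx

theorem Ideal.fg_of_fg_comap_ringEquiv {A B : Type*} [CommRing A] [CommRing B] (e : B ≃+* A)
    {I : Ideal A} (h : (I.comap (e : B →+* A)).FG) : I.FG := by
  rw [← Ideal.map_comap_of_surjective (e : B →+* A) e.surjective I]
  exact h.map _

variable {E : Type*} [NormedAddCommGroup E] [NormedSpace ℂ E]

/-- Germs in the first variable viewed as germs in two variables. -/
def germFst : analyticGerms E →ₐ[ℂ] analyticGerms (E × ℂ) :=
  germComp Prod.fst analyticAt_fst rfl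

/-- The last coordinate. -/
def germSnd : analyticGerms (E × ℂ) := mkGerm Prod.snd analyticAt_snd

theorem mkGerm_sum {ι : Type*} (s : Finset ι) (f : ι → E → ℂ) (hf : ∀ i, AnalyticAt ℂ (f i) 0) :
    mkGerm (fun z => ∑ i ∈ s, f i z) (Finset.analyticAt_fun_sum s fun i _ => hf i)
      = ∑ i ∈ s, mkGerm (f i) (hf i) := by
  classical
  induction s using Finset.induction_on with
  | empty => simp; rfl
  | insert a s ha ih =>
    simp only [Finset.sum_insert ha, ← ih]
    rfl

/-- Weierstrass preparation and division in the ring of germs. -/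
theorem germ_weierstrass [CompleteSpace E] {f : E × ℂ → ℂ} (hf : AnalyticAt ℂ f 0) {b : ℕ}
    {u : ℂ → ℂ} (hu : ContinuousAt u 0) (hu0 : u 0 ≠ 0)
    (hfu : ∀ᶠ t in 𝓝 (0 : ℂ), f (0, t) = t ^ b * u t) :
    ∃ a : Fin b → analyticGerms E, (∀ j, germEval (a j) = 0) ∧
      (∃ e, IsUnit e ∧
        mkGerm f hf = (germSnd ^ b + ∑ j, germFst (a j) * germSnd ^ (j : ℕ)) * e) ∧
      ∀ G, ∃ (q : analyticGerms (E × ℂ)) (r : Fin b → analyticGerms E),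
        G = (germSnd ^ b + ∑ j, germFst (a j) * germSnd ^ (j : ℕ)) * q
          + ∑ j, germFst (r j) * germSnd ^ (j : ℕ) := by
  obtain ⟨a, ha, ha0, ⟨e, he, he0, hfe⟩, hdiv⟩ := weierstrass hf hu hu0 hfu
  have hcomp : ∀ r : E → Fin b → ℂ, AnalyticAt ℂ r 0 → ∀ j, AnalyticAt ℂ (fun z => r z j) 0 :=
    fun r hr => analyticAt_pi_iff.1 hr
  have hcomp' : ∀ r : E → Fin b → ℂ, AnalyticAt ℂ r 0 → ∀ j : Fin b,
      AnalyticAt ℂ (fun x : E × ℂ => r x.1 j * x.2 ^ (j : ℕ)) 0 := fun r hr j =>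
    (AnalyticAt.comp (g := fun z => r z j) (f := Prod.fst) (x := (0 : E × ℂ)) (hcomp r hr j)
      analyticAt_fst).mul (analyticAt_snd.pow _)
  have hsum : ∀ (r : E → Fin b → ℂ) (hr : AnalyticAt ℂ r 0),
      ∑ j, germFst (mkGerm (fun z => r z j) (hcomp r hr j)) * germSnd ^ (j : ℕ)
        = mkGerm (fun x : E × ℂ => ∑ j, r x.1 j * x.2 ^ (j : ℕ))
          (Finset.analyticAt_fun_sum _ fun j _ => hcomp' r hr j) := by
    intro r hr
    rw [mkGerm_sum _ _ (hcomp' r hr)]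
    rfl
  refine ⟨fun j => mkGerm (fun z => a z j) (hcomp a ha j), fun j => by simp [ha0],
    ⟨mkGerm e he, isUnit_iff_germEval_ne_zero.2 he0, ?_⟩, fun G => ?_⟩
  · rw [hsum a ha]
    refine Subtype.ext (Filter.Germ.coe_eq.2 ?_)
    filter_upwards [hfe] with x hx
    simpa [monicEval] using hx
  · obtain ⟨G, hG, rfl⟩ := exists_mkGerm G
    obtain ⟨q, r, hq, hr, h⟩ := hdiv G hG
    refine ⟨mkGerm q hq, fun j => mkGerm (fun z => r z j) (hcomp r hr j), ?_⟩
    rw [hsum a ha, hsum r hr]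
    refine Subtype.ext (Filter.Germ.coe_eq.2 ?_)
    filter_upwards [h] with x hx
    simpa [monicEval] using hx

theorem germEval_injective_of_subsingleton [Subsingleton E] :
    Function.Injective (germEval (E := E)) := by
  rw [injective_iff_map_eq_zero]
  intro x hx
  obtain ⟨f, hf, rfl⟩ := exists_mkGerm x
  refine mkGerm_eq_zero_iff.2 (Eventually.of_forall fun z => ?_)
  rw [Subsingleton.elim z 0]
  exact hx

instance isNoetherianRing_analyticGerms (n : ℕ) :
    IsNoetherianRing (analyticGerms (Fin n → ℂ)) := by
  induction n with
  | zero =>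
    refine isNoetherianRing_of_ringEquiv ℂ (RingEquiv.ofBijective germEval
      ⟨germEval_injective_of_subsingleton, fun c => ?_⟩ : analyticGerms (Fin 0 → ℂ) ≃+* ℂ).symm
    exact ⟨mkGerm (fun _ => c) analyticAt_const, rfl⟩
  | succ n ih =>
    rw [isNoetherianRing_iff_ideal_fg]
    intro I
    by_cases hI : I = ⊥
    · rw [hI]; exact Submodule.fg_bot
    obtain ⟨x, hxI, hx0⟩ := Submodule.exists_mem_ne_zero_of_ne_bot hI
    obtain ⟨f, hf, rfl⟩ := exists_mkGerm x
    obtain ⟨L, b, u, hu, hu0, hfu⟩ := exists_regular_coordinates hf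
      (fun h => hx0 (mkGerm_eq_zero_iff.2 h))
    have hfL : AnalyticAt ℂ (f ∘ L) 0 := AnalyticAt.comp (by rwa [map_zero]) (L.analyticAt 0)
    obtain ⟨a, -, ⟨e, he, hfe⟩, hdiv⟩ := germ_weierstrass hfL hu.continuousAt hu0 hfu
    refine Ideal.fg_of_fg_comap_ringEquiv (germEquiv L).symm.toRingEquiv
      (Ideal.fg_of_forall_exists_remainder germFst.toRingHom (fun j : Fin b => germSnd ^ (j : ℕ))
        (?_ : germSnd ^ b + ∑ j, germFst (a j) * germSnd ^ (j : ℕ) ∈ _) hdiv)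
    rw [← Ideal.mul_unit_mem_iff_mem _ he, ← hfe, Ideal.mem_comap]
    have h1 : (germEquiv L).symm (mkGerm (f ∘ L) hfL) = mkGerm f hf :=
      (germEquiv L).symm_apply_apply (mkGerm f hf)
    exact h1 ▸ hxI

end AnalyticGerms

section AnalyticGerms

open IsLocalRing RingTheory.Sequence
open scoped Pointwise

variable {E : Type*} [NormedAddCommGroup E] [NormedSpace ℂ E]

/-- Restriction of germs to the hyperplane where the last coordinate vanishes. -/
def germRestrict : analyticGerms (E × ℂ) →ₐ[ℂ] analyticGerms E :=
  germComp (fun z => (z, 0)) (analyticAt_id.prod analyticAt_const) rfl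

theorem germRestrict_germFst (x : analyticGerms E) : germRestrict (germFst x) = x := by
  obtain ⟨f, hf, rfl⟩ := exists_mkGerm x
  rfl

theorem germRestrict_germSnd : germRestrict (germSnd (E := E)) = 0 := rfl

theorem germEval_germFst (x : analyticGerms E) : germEval (germFst x) = germEval x := by
  obtain ⟨f, hf, rfl⟩ := exists_mkGerm x
  rfl

theorem exists_eq_germSnd_mul_add [CompleteSpace E] (G : analyticGerms (E × ℂ)) :
    ∃ q, G = germSnd * q + germFst (germRestrict G) := by
  obtain ⟨a, -, ⟨e, he, hae⟩, hdiv⟩ := germ_weierstrass (E := E) (f := Prod.snd) analyticAt_snd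
    (b := 1) (u := fun _ => 1) continuousAt_const one_ne_zero (by simp)
  have ha : a 0 = 0 := by
    have h1 := congrArg germRestrict hae
    have h2 : germRestrict (mkGerm (Prod.snd : E × ℂ → ℂ) analyticAt_snd) = 0 := rfl
    rw [h2] at h1
    simp only [Finset.univ_unique, Finset.sum_singleton, map_mul, map_add,
      germRestrict_germSnd, germRestrict_germFst, Fin.default_eq_zero, Fin.val_zero, pow_zero,
      pow_one, mul_one, zero_add] at h1
    exact (he.map germRestrict).mul_left_eq_zero.1 h1.symm
  obtain ⟨q, r, h⟩ := hdiv G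
  simp only [Finset.univ_unique, Finset.sum_singleton, Fin.default_eq_zero, Fin.val_zero,
    pow_zero, pow_one, mul_one, ha, map_zero, add_zero] at h
  refine ⟨q, ?_⟩
  have h1 := congrArg germRestrict h
  simp only [map_add, map_mul, germRestrict_germSnd, germRestrict_germFst, zero_mul, zero_add]
    at h1
  rw [h1]
  exact h

theorem germSnd_mul_eq_zero {x : analyticGerms (E × ℂ)} (h : germSnd * x = 0) : x = 0 := by
  obtain ⟨f, hf, rfl⟩ := exists_mkGerm x
  have h' : ∀ᶠ x : E × ℂ in 𝓝 0, x.2 * f x = 0 :=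
    mkGerm_eq_zero_iff (hf := analyticAt_snd.mul hf).1 h
  refine mkGerm_eq_zero_iff.2 ?_
  filter_upwards [eventually_eventually_nhds.2 h', hf.eventually_analyticAt] with x hx hfx
  by_cases hx0 : x.2 = 0
  · have ht : Tendsto (fun t : ℂ => (x.1, t)) (𝓝[≠] 0) (𝓝 x) := by
      have hc : Tendsto (fun t : ℂ => (x.1, t)) (𝓝 0) (𝓝 (x.1, 0)) := by
        exact Continuous.tendsto (by fun_prop) 0
      rw [show x = (x.1, 0) from Prod.ext rfl hx0]
      exact hc.mono_left nhdsWithin_le_nhds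
    refine tendsto_nhds_unique (hfx.continuousAt.tendsto.comp ht) ?_
    refine tendsto_const_nhds.congr' ?_
    filter_upwards [ht.eventually hx, self_mem_nhdsWithin] with t ht ht0
    exact ((mul_eq_zero.1 ht).resolve_left ht0).symm
  · exact (mul_eq_zero.1 hx.self_of_nhds).resolve_left hx0

/-- Regular sequences lift along the quotient by a nonzerodivisor. -/
theorem isRegular_cons_map_of_surjective {A B : Type*} [CommRing A] [CommRing B] (π : B →+* A)
    {σ : A → B} (hσ : ∀ a, π (σ a) = a) {t : B} (ht : ∀ x, t * x = 0 → x = 0)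
    (hker : ∀ x, π x = 0 ↔ ∃ q, x = t * q) {rs : List A} (h : IsRegular A rs) :
    IsRegular B (t :: rs.map σ) := by
  have htr : IsSMulRegular B t := by
    intro x y hxy
    exact sub_eq_zero.1 (ht _ (by simpa [mul_sub, sub_eq_zero] using hxy))
  refine (isRegular_cons_iff _ _ _).2 ⟨htr, ?_⟩
  let K : AddSubgroup B := (t • (⊤ : Submodule B B)).toAddSubgroup
  have hK : K = π.toAddMonoidHom.ker := by
    ext x
    refine Iff.trans ?_ (hker x).symm
    refine (Submodule.mem_smul_pointwise_iff_exists _ _ _).trans ?_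
    simp [eq_comm]
  let e : QuotSMulTop t B ≃+ A := (QuotientAddGroup.quotientAddEquivOfEq hK).trans
    (QuotientAddGroup.quotientKerEquivOfRightInverse π.toAddMonoidHom σ hσ)
  have he : ∀ x : B, e (Submodule.Quotient.mk x) = π x := fun x => rfl
  refine (AddEquiv.isRegular_congr (e := e) ?_).2 h
  refine List.forall₂_map_left_iff.2 (List.forall₂_same.2 fun r _ x => ?_)
  obtain ⟨x, rfl⟩ := Submodule.mkQ_surjective _ x
  rw [← map_smul, Submodule.mkQ_apply, Submodule.mkQ_apply, he, he]
  simp [hσ]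

/-- The ring of germs of analytic functions in `n` variables has a regular sequence of
length `n`. -/
theorem exists_isRegular_analyticGerms (n : ℕ) :
    ∃ rs : List (analyticGerms (Fin n → ℂ)), rs.length = n ∧
      (∀ r ∈ rs, r ∈ maximalIdeal (analyticGerms (Fin n → ℂ))) ∧
      IsRegular (analyticGerms (Fin n → ℂ)) rs := by
  induction n with
  | zero => exact ⟨[], rfl, by simp, IsRegular.nil _ _⟩
  | succ n ih =>
    obtain ⟨rs, hlen, hrs, h⟩ := ih
    obtain ⟨L, -⟩ := exists_clm_equiv_apply_eq (n := n) (v := fun _ => 1)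
      fun h => one_ne_zero (congrFun h 0)
    have h1 := isRegular_cons_map_of_surjective (germRestrict (E := Fin n → ℂ)).toRingHom
      (σ := germFst) germRestrict_germFst (t := germSnd) (fun x => germSnd_mul_eq_zero)
      (fun x => ⟨fun hx => ?_, ?_⟩) h
    · refine ⟨(germSnd :: rs.map germFst).map (germEquiv L).symm, by simp [hlen], ?_, ?_⟩
      · intro r hr
        obtain ⟨s, hs, rfl⟩ := List.mem_map.1 hr
        have hs' : s ∈ maximalIdeal (analyticGerms ((Fin n → ℂ) × ℂ)) := by
          rw [mem_maximalIdeal_iff_germEval]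
          rcases List.mem_cons.1 hs with rfl | hs
          · rfl
          · obtain ⟨r, hr', rfl⟩ := List.mem_map.1 hs
            rw [germEval_germFst]
            exact mem_maximalIdeal_iff_germEval.1 (hrs r hr')
        exact fun hu => hs' ((MulEquiv.isUnit_map (germEquiv L).symm).1 hu)
      · refine (AddEquiv.isRegular_congr (e := (germEquiv L).symm.toRingEquiv.toAddEquiv) ?_).1 h1
        refine List.forall₂_map_right_iff.2 (List.forall₂_same.2 fun r _ x => ?_)
        exact map_mul (germEquiv L).symm r x
    · obtain ⟨q, hq⟩ := exists_eq_germSnd_mul_add x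
      have hx' : germRestrict x = 0 := hx
      rw [hx', map_zero, add_zero] at hq
      exact ⟨q, hq⟩
    · rintro ⟨q, rfl⟩
      change germRestrict (germSnd * q) = 0
      rw [map_mul, germRestrict_germSnd, zero_mul]

theorem ringKrullDim_analyticGerms_ge (n : ℕ) :
    (n : WithBot ℕ∞) ≤ ringKrullDim (analyticGerms (Fin n → ℂ)) := by
  obtain ⟨rs, hlen, -, h⟩ := exists_isRegular_analyticGerms n
  have hnt : Nontrivial (analyticGerms (Fin n → ℂ) ⧸ Ideal.ofList rs) := by
    rw [Ideal.Quotient.nontrivial_iff]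
    intro hcon
    exact h.top_ne_smul (by rw [hcon]; simp)
  rw [← ringKrullDim_add_length_eq_ringKrullDim_of_isRegular rs h, hlen]
  exact le_add_of_nonneg_left ringKrullDim_nonneg_of_nontrivial

end AnalyticGerms

section Nullstellensatz

open IsLocalRing

variable {E : Type*} [NormedAddCommGroup E] [NormedSpace ℂ E]

variable (E) in
/-- The ring of functions analytic at the origin. -/
def analyticFuns : Subalgebra ℂ (E → ℂ) where
  carrier := {f | AnalyticAt ℂ f 0}
  mul_mem' hf hg := hf.mul hg
  add_mem' hf hg := hf.add hg
  algebraMap_mem' _ := analyticAt_const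

/-- The germ map on functions analytic at the origin. -/
def toGerm : analyticFuns E →+* analyticGerms E where
  toFun f := mkGerm f.1 f.2
  map_one' := rfl
  map_zero' := rfl
  map_add' _ _ := rfl
  map_mul' _ _ := rfl

/-- Evaluation at a point. -/
def evalAt (z : E) : analyticFuns E →+* ℂ :=
  (Pi.evalRingHom (fun _ : E => ℂ) z).comp (analyticFuns E).val.toRingHom

theorem evalAt_apply (z : E) (f : analyticFuns E) : evalAt z f = f.1 z := rfl

/-- Small coefficients force small roots. -/
theorem eventually_norm_lt_of_monicEval_eq_zero {X : Type*} [TopologicalSpace X] [Zero X]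
    {b : ℕ} {a : X → Fin b → ℂ}
    (ha : ContinuousAt a 0) (ha0 : a 0 = 0) {δ : ℝ} (hδ : 0 < δ) :
    ∀ᶠ z in 𝓝 0, ∀ t : ℂ, monicEval (a z) t = 0 → ‖t‖ < δ := by
  have hlim : Tendsto (fun z => ∑ j : Fin b, ‖a z j‖ / δ ^ (b - j)) (𝓝 0) (𝓝 0) := by
    have h1 : ∀ j : Fin b, Tendsto (fun z => ‖a z j‖ / δ ^ (b - j)) (𝓝 0) (𝓝 0) := fun j => by
      have := ((tendsto_pi_nhds.1 ha j).norm).div_const (δ ^ (b - j))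
      simpa [ha0] using this
    simpa using tendsto_finsetSum Finset.univ fun j _ => h1 j
  filter_upwards [hlim.eventually_lt_const one_pos] with z hz t ht
  by_contra! hcon
  have htpos : 0 < ‖t‖ := hδ.trans_le hcon
  have h1 : t ^ b = -∑ j : Fin b, a z j * t ^ (j : ℕ) := by
    simpa [monicEval, add_eq_zero_iff_eq_neg] using ht
  have h2 : ‖t‖ ^ b ≤ ∑ j : Fin b, ‖a z j‖ * ‖t‖ ^ (j : ℕ) := by
    rw [← norm_pow, h1, norm_neg]
    exact (norm_sum_le _ _).trans (le_of_eq (by simp))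
  have h3 : ∑ j : Fin b, ‖a z j‖ * ‖t‖ ^ (j : ℕ)
      ≤ ∑ j : Fin b, ‖a z j‖ / δ ^ (b - j) * ‖t‖ ^ b := by
    refine Finset.sum_le_sum fun j _ => ?_
    rw [div_mul_eq_mul_div, mul_div_assoc]
    refine mul_le_mul_of_nonneg_left ?_ (norm_nonneg _)
    rw [le_div_iff₀ (by positivity)]
    calc ‖t‖ ^ (j : ℕ) * δ ^ (b - j) ≤ ‖t‖ ^ (j : ℕ) * ‖t‖ ^ (b - j) := by gcongr
      _ = ‖t‖ ^ b := by rw [← pow_add]; congr 1; omega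
  rw [← Finset.sum_mul] at h3
  have h4 : 0 < ‖t‖ ^ b := by positivity
  nlinarith

/-- If enough combinations `∑ i, s ^ i • c i t` with natural number coefficients vanish at some
point of a small finite set, then all the `c i` vanish simultaneously at a point of the set. -/
theorem exists_forall_eq_zero_of_sum_pow_mul {k b : ℕ} {T : Finset ℂ} (hT : T.card ≤ b)
    (c : Fin k → ℂ → ℂ)
    (h : ∀ s : Fin (b * k + 1), ∃ t ∈ T, ∑ i : Fin k, ((s : ℕ) : ℂ) ^ (i : ℕ) * c i t = 0) :
    ∃ t ∈ T, ∀ i, c i t = 0 := by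
  choose τ hτ hτ0 using h
  obtain ⟨t, ht, hcard⟩ := Finset.exists_lt_card_fiber_of_mul_lt_card_of_maps_to
    (s := Finset.univ) (t := T) (f := τ) (n := k) (fun s _ => hτ s)
    (by
      rw [Finset.card_univ, Fintype.card_fin]
      exact Nat.lt_succ_of_le (Nat.mul_le_mul_right _ hT))
  refine ⟨t, ht, ?_⟩
  let p : Polynomial ℂ := ∑ i : Fin k, Polynomial.C (c i t) * Polynomial.X ^ (i : ℕ)
  have hp : p = 0 := by
    refine Polynomial.eq_zero_of_degree_lt_of_eval_finset_eq_zero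
      ((Finset.univ.filter fun s => τ s = t).image fun s : Fin (b * k + 1) => ((s : ℕ) : ℂ)) ?_ ?_
    · rw [Finset.card_image_of_injective _ fun x y hxy => Fin.ext (Nat.cast_injective hxy)]
      have h1 : p.degree < k := by
        refine Polynomial.degree_sum_fin_lt _
      exact h1.trans (by exact_mod_cast hcard)
    · intro x hx
      obtain ⟨s, hs, rfl⟩ := Finset.mem_image.1 hx
      have := hτ0 s
      rw [(Finset.mem_filter.1 hs).2] at this
      rw [← this, Polynomial.eval_finsetSum]
      exact Finset.sum_congr rfl fun i _ => by
        rw [Polynomial.eval_mul, Polynomial.eval_C, Polynomial.eval_pow, Polynomial.eval_X, mul_comm]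
  intro i
  have := congrArg (fun q => Polynomial.coeff q i) hp
  simpa [p, Polynomial.finsetSum_coeff, Polynomial.coeff_X_pow, Fin.val_inj] using this

variable (E) in
/-- Polynomials over the ring of analytic functions of the first variable, as germs. -/
def polyGerm : Polynomial (analyticFuns E) →+* analyticGerms (E × ℂ) :=
  Polynomial.eval₂RingHom ((germFst (E := E)).toRingHom.comp toGerm) germSnd

theorem polyGerm_C (f : analyticFuns E) : polyGerm E (Polynomial.C f) = germFst (toGerm f) :=
  Polynomial.eval₂_C _ _

theorem polyGerm_X : polyGerm E Polynomial.X = germSnd := Polynomial.eval₂_X _ _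

theorem coe_polyGerm (p : Polynomial (analyticFuns E)) :
    (polyGerm E p : Filter.Germ (𝓝 (0 : E × ℂ)) ℂ)
      = ↑(fun x : E × ℂ => (p.map (evalAt x.1)).eval x.2) := by
  induction p using Polynomial.induction_on with
  | C f =>
    rw [polyGerm_C]
    simp only [Polynomial.map_C, Polynomial.eval_C]
    rfl
  | add p q hp hq =>
    rw [map_add]
    simp only [Polynomial.map_add, Polynomial.eval_add]
    exact congrArg₂ (· + ·) hp hq
  | monomial n f h =>
    rw [pow_succ, ← mul_assoc, map_mul, polyGerm_X]
    simp only [Polynomial.map_mul _ (p := _ * _), Polynomial.eval_mul, Polynomial.map_X,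
      Polynomial.eval_X] at h ⊢
    exact congrArg (· * ((germSnd : analyticGerms (E × ℂ)) : Filter.Germ (𝓝 (0 : E × ℂ)) ℂ)) h

/-- Elimination of the last variable from a system of analytic equations. -/
theorem maximalIdeal_le_radical_span_of_regular [CompleteSpace E]
    (ih : ∀ (k : ℕ) (F : Fin k → E → ℂ) (hF : ∀ i, AnalyticAt ℂ (F i) 0),
      (∀ᶠ z in 𝓝 0, (∀ i, F i z = 0) → z = 0) →
      maximalIdeal (analyticGerms E) ≤ (Ideal.span (Set.range fun i => mkGerm (F i) (hF i))).radical)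
    {k : ℕ} {F : Fin k → E × ℂ → ℂ} (hF : ∀ i, AnalyticAt ℂ (F i) 0)
    (h : ∀ᶠ z in 𝓝 0, (∀ i, F i z = 0) → z = 0) (i₀ : Fin k) {b : ℕ} {u : ℂ → ℂ}
    (hu : ContinuousAt u 0) (hu0 : u 0 ≠ 0) (hfu : ∀ᶠ t in 𝓝 (0 : ℂ), F i₀ (0, t) = t ^ b * u t) :
    maximalIdeal (analyticGerms (E × ℂ)) ≤
      (Ideal.span (Set.range fun i => mkGerm (F i) (hF i))).radical := by
  obtain ⟨a, ha, ha0, ⟨e, he, he0, hfe⟩, hdiv⟩ := weierstrass (hF i₀) hu hu0 hfu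
  choose q r hq hr hqr using fun i => hdiv (F i) (hF i)
  set J := Ideal.span (Set.range fun i => mkGerm (F i) (hF i)) with hJ
  let A : Fin b → analyticFuns E := fun j => ⟨fun z => a z j, analyticAt_pi_iff.1 ha j⟩
  let B : Fin k → Fin b → analyticFuns E := fun i j =>
    ⟨fun z => r i z j, analyticAt_pi_iff.1 (hr i) j⟩
  let P : Polynomial (analyticFuns E) :=
    Polynomial.X ^ b + ∑ j : Fin b, Polynomial.C (A j) * Polynomial.X ^ (j : ℕ)
  let H : Fin k → Polynomial (analyticFuns E) := fun i =>
    ∑ j : Fin b, Polynomial.C (B i j) * Polynomial.X ^ (j : ℕ)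
  let G : ℕ → Polynomial (analyticFuns E) := fun s =>
    ∑ i : Fin k, (s : Polynomial (analyticFuns E)) ^ (i : ℕ) * H i
  let N : ℕ → analyticFuns E := fun s => P.resultant (G s) b (b + 1)
  have hPdeg : P.Monic := by
    refine Polynomial.monic_X_pow_add ?_
    exact Polynomial.degree_sum_fin_lt _
  have hPnat : P.natDegree ≤ b := by
    refine Polynomial.natDegree_le_of_degree_le (Polynomial.degree_add_le_of_degree_le ?_ ?_)
    · exact Polynomial.degree_X_pow_le b
    · exact (Polynomial.degree_sum_fin_lt _).le
  have hHdeg : ∀ i, (H i).natDegree ≤ b := fun i =>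
    Polynomial.natDegree_le_of_degree_le (Polynomial.degree_sum_fin_lt _).le
  have hGdeg : ∀ s, (G s).natDegree ≤ b + 1 := fun s => by
    refine (Polynomial.natDegree_sum_le_of_forall_le _ _ fun i _ => ?_).trans (Nat.le_succ b)
    rw [← Nat.cast_pow, ← nsmul_eq_mul]
    exact (Polynomial.natDegree_smul_le _ _).trans (hHdeg i)
  have hPeval : ∀ z t, (P.map (evalAt z)).eval t = monicEval (a z) t := fun z t => by
    simp [P, monicEval, Polynomial.eval_finsetSum, Polynomial.map_sum, evalAt_apply, A]
  have hHeval : ∀ i z t, ((H i).map (evalAt z)).eval t = ∑ j, r i z j * t ^ (j : ℕ) := by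
    intro i z t
    simp [H, Polynomial.eval_finsetSum, Polynomial.map_sum, evalAt_apply, B]
  have hGeval : ∀ s z t, ((G s).map (evalAt z)).eval t
      = ∑ i : Fin k, (s : ℂ) ^ (i : ℕ) * ((H i).map (evalAt z)).eval t := fun s z t => by
    simp [G, Polynomial.eval_finsetSum, Polynomial.map_sum]
  have hroot : ∀ s z, (N s).1 z = 0 → ∃ t ∈ (P.map (evalAt z)).roots.toFinset,
      ((G s).map (evalAt z)).eval t = 0 := fun s z hz => by
    have hmon : (P.map (evalAt z)).Monic := hPdeg.map _
    have hdeg : (P.map (evalAt z)).natDegree = b := by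
      refine le_antisymm (Polynomial.natDegree_map_le.trans hPnat) ?_
      refine Polynomial.le_natDegree_of_ne_zero ?_
      rw [Polynomial.coeff_map]
      have : P.coeff b = 1 := by
        have h0 : (∑ j : Fin b, Polynomial.C (A j) * Polynomial.X ^ (j : ℕ)).coeff b = 0 :=
          Polynomial.coeff_eq_zero_of_degree_lt (Polynomial.degree_sum_fin_lt _)
        simp only [P, Polynomial.coeff_add, Polynomial.coeff_X_pow_self, h0, add_zero]
      rw [this, map_one]
      exact one_ne_zero
    have h1 := Polynomial.resultant_eq_prod_eval (P.map (evalAt z)) ((G s).map (evalAt z)) (b + 1)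
      (Polynomial.natDegree_map_le.trans (hGdeg s)) (IsAlgClosed.splits _)
    rw [hdeg, Polynomial.resultant_map_map, evalAt_apply, hz, hmon.leadingCoeff, one_pow, one_mul,
      eq_comm, Multiset.prod_eq_zero_iff, Multiset.mem_map] at h1
    obtain ⟨t, ht, ht0⟩ := h1
    exact ⟨t, Multiset.mem_toFinset.2 ht, ht0⟩
  have hiso : ∀ᶠ z in 𝓝 (0 : E), (∀ s : Fin (b * k + 1), (N s).1 z = 0) → z = 0 := by
    have hall := h.and (eventually_all.2 hqr)
    rw [show (0 : E × ℂ) = (0, 0) from rfl, nhds_prod_eq] at hall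
    obtain ⟨p₁, hp₁, p₂, hp₂, hp⟩ := eventually_prod_iff.1 hall
    obtain ⟨δ, hδ, hball⟩ := Metric.eventually_nhds_iff.1 hp₂
    filter_upwards [hp₁, eventually_norm_lt_of_monicEval_eq_zero ha.continuousAt ha0 hδ]
      with z hz hroots hN
    have hmon : (P.map (evalAt z)).Monic := hPdeg.map _
    obtain ⟨t, ht, hct⟩ := exists_forall_eq_zero_of_sum_pow_mul
      (T := (P.map (evalAt z)).roots.toFinset)
      ((Multiset.toFinset_card_le _).trans ((Polynomial.card_roots' _).trans
        (Polynomial.natDegree_map_le.trans hPnat)))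
      (fun i t => ((H i).map (evalAt z)).eval t)
      (fun s => by
        obtain ⟨t, ht, h0⟩ := hroot s z (hN s)
        exact ⟨t, ht, by rw [← hGeval]; exact h0⟩)
    have ht0 : monicEval (a z) t = 0 := by
      rw [← hPeval]
      exact ((Polynomial.mem_roots hmon.ne_zero).1 (Multiset.mem_toFinset.1 ht))
    have hδt := hball (y := t) (by simpa using hroots t ht0)
    obtain ⟨h1, h2⟩ := hp hz hδt
    refine congrArg Prod.fst (h1 fun i => ?_)
    rw [h2 i]
    simp only
    rw [ht0, zero_mul, zero_add, ← hHeval]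
    exact hct i
  have hN := ih (b * k + 1) (fun s => (N s).1) (fun s => (N s).2) hiso
  have hPJ : polyGerm E P ∈ J := by
    have h1 : mkGerm (F i₀) (hF i₀) = polyGerm E P * mkGerm e he := by
      refine Subtype.ext ?_
      refine Eq.trans ?_ (congrArg (· * (mkGerm e he).1) (coe_polyGerm P).symm)
      refine Filter.Germ.coe_eq.2 ?_
      filter_upwards [hfe] with x hx
      rw [hx, ← hPeval]
    have hunit : IsUnit (mkGerm e he) := isUnit_iff_germEval_ne_zero.2 he0
    have h2 : polyGerm E P * mkGerm e he ∈ J := h1 ▸ Ideal.subset_span ⟨i₀, rfl⟩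
    exact (Ideal.mul_unit_mem_iff_mem J hunit).1 h2
  have hHJ : ∀ i, polyGerm E (H i) ∈ J := fun i => by
    have h1 : mkGerm (F i) (hF i) = polyGerm E P * mkGerm (q i) (hq i) + polyGerm E (H i) := by
      refine Subtype.ext ?_
      refine Eq.trans ?_ (congrArg₂ (fun x y => x * (mkGerm (q i) (hq i)).1 + y)
        (coe_polyGerm P).symm (coe_polyGerm (H i)).symm)
      refine Filter.Germ.coe_eq.2 ?_
      filter_upwards [hqr i] with x hx
      rw [hx, ← hPeval, ← hHeval]
    have h2 : polyGerm E (H i) = mkGerm (F i) (hF i) - polyGerm E P * mkGerm (q i) (hq i) := by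
      rw [h1]; ring
    rw [h2]
    exact J.sub_mem (Ideal.subset_span ⟨i, rfl⟩) (J.mul_mem_right _ hPJ)
  have hNJ : ∀ s, germFst (toGerm (N s)) ∈ J := fun s => by
    obtain ⟨p, q, -, -, hpq⟩ := Polynomial.exists_mul_add_mul_eq_C_resultant P (G s) hPnat
      (hGdeg s) (Or.inr b.succ_ne_zero)
    rw [← polyGerm_C, ← hpq, map_add, map_mul, map_mul]
    refine J.add_mem (J.mul_mem_right _ hPJ) (J.mul_mem_right _ ?_)
    rw [map_sum]
    refine J.sum_mem fun i _ => ?_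
    rw [map_mul]
    exact J.mul_mem_left _ (hHJ i)
  have hfst : ∀ y ∈ maximalIdeal (analyticGerms E), germFst y ∈ J.radical := fun y hy => by
    obtain ⟨m, hm⟩ := hN hy
    refine ⟨m, ?_⟩
    rw [← map_pow]
    refine (Ideal.span_le (I := J.comap (germFst (E := E)))).2 ?_ hm
    rintro _ ⟨s, rfl⟩
    exact hNJ s
  have hsnd : germSnd ∈ J.radical := by
    refine J.radical_isRadical ⟨b, ?_⟩
    have h1 : polyGerm E P
        = germSnd ^ b + ∑ j : Fin b, germFst (toGerm (A j)) * germSnd ^ (j : ℕ) := by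
      simp only [P, map_add, map_sum, map_mul, map_pow, polyGerm_C, polyGerm_X]
    have h2 : germSnd ^ b = polyGerm E P
        - ∑ j : Fin b, germFst (toGerm (A j)) * germSnd ^ (j : ℕ) := by rw [h1]; ring
    rw [h2]
    refine J.radical.sub_mem (J.le_radical hPJ) (J.radical.sum_mem fun j _ => ?_)
    refine J.radical.mul_mem_right _ (hfst _ ?_)
    rw [mem_maximalIdeal_iff_germEval]
    exact congrFun ha0 j
  intro x hx
  obtain ⟨q, hq⟩ := exists_eq_germSnd_mul_add x
  rw [hq]
  refine J.radical.add_mem (J.radical.mul_mem_right _ hsnd) (hfst _ ?_)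
  rw [mem_maximalIdeal_iff_germEval] at hx ⊢
  rw [hq, map_add, map_mul, germEval_germFst, show germEval (germSnd (E := E)) = 0 from rfl,
    zero_mul, zero_add] at hx
  exact hx

theorem maximalIdeal_le_radical_span_of_ringEquiv {A B : Type*} [CommRing A] [CommRing B]
    [IsLocalRing A] [IsLocalRing B] (e : A ≃+* B) {ι : Type*} {f : ι → A} {g : ι → B}
    (hfg : ∀ i, e (f i) = g i)
    (h : maximalIdeal B ≤ (Ideal.span (Set.range g)).radical) :
    maximalIdeal A ≤ (Ideal.span (Set.range f)).radical := by
  intro x hx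
  obtain ⟨m, hm⟩ := h (show e x ∈ maximalIdeal B from
    fun hu => hx ((MulEquiv.isUnit_map e).1 hu))
  refine ⟨m, ?_⟩
  have h1 : Ideal.span (Set.range g) ≤ (Ideal.span (Set.range f)).comap e.symm.toRingHom := by
    refine Ideal.span_le.2 ?_
    rintro _ ⟨i, rfl⟩
    rw [← hfg]
    change e.symm (e (f i)) ∈ Ideal.span (Set.range f)
    rw [e.symm_apply_apply]
    exact Ideal.subset_span ⟨i, rfl⟩
  simpa using h1 hm

/-- The local Nullstellensatz at an isolated zero. -/
theorem maximalIdeal_le_radical_span_of_isolated_zero (n : ℕ) :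
    ∀ (k : ℕ) (F : Fin k → (Fin n → ℂ) → ℂ) (hF : ∀ i, AnalyticAt ℂ (F i) 0),
      (∀ᶠ z in 𝓝 0, (∀ i, F i z = 0) → z = 0) →
      maximalIdeal (analyticGerms (Fin n → ℂ)) ≤
        (Ideal.span (Set.range fun i => mkGerm (F i) (hF i))).radical := by
  induction n with
  | zero =>
    intro k F hF _ x hx
    have hx0 : x = 0 := germEval_injective_of_subsingleton
      ((mem_maximalIdeal_iff_germEval.1 hx).trans (map_zero _).symm)
    rw [hx0]
    exact zero_mem _
  | succ n ih =>
    intro k F hF h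
    have hne : ∃ i, ¬ ∀ᶠ z in 𝓝 0, F i z = 0 := by
      by_contra! hcon
      have h0 : ∀ᶠ z in 𝓝[≠] (0 : Fin (n + 1) → ℂ), z = 0 :=
        Filter.Eventually.filter_mono nhdsWithin_le_nhds
          ((h.and (eventually_all.2 hcon)).mono fun z hz => hz.1 hz.2)
      obtain ⟨z, hz, hz'⟩ := (h0.and self_mem_nhdsWithin).exists
      exact hz' hz
    obtain ⟨i₀, hi₀⟩ := hne
    obtain ⟨L, b, u, hu, hu0, hfu⟩ := exists_regular_coordinates (hF i₀) hi₀
    have hL : ∀ i, AnalyticAt ℂ (F i ∘ L) 0 := fun i =>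
      AnalyticAt.comp (by rw [map_zero]; exact hF i) (L.analyticAt 0)
    refine maximalIdeal_le_radical_span_of_ringEquiv (germEquiv L).toRingEquiv
      (g := fun i => mkGerm (F i ∘ L) (hL i)) (fun i => rfl) ?_
    refine maximalIdeal_le_radical_span_of_regular ih hL ?_ i₀ hu.continuousAt hu0 hfu
    have hc : Tendsto L (𝓝 0) (𝓝 0) := by
      simpa using L.continuous.tendsto 0
    filter_upwards [hc.eventually h] with z hz hz0
    exact (map_eq_zero_iff L L.injective).1 (hz hz0)

end Nullstellensatz

section Depth

universe v
variable {R : Type v} [CommRing R] [IsLocalRing R] [IsNoetherianRing R]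

open IsLocalRing RingTheory.Sequence CategoryTheory.Abelian
open scoped Pointwise

/-- A module with a regular sequence of length `k` has associated primes of dimension at
least `k`. -/
theorem length_le_ringKrullDim_quotient_of_isRegular {rs : List R}
    (hrs : ∀ r ∈ rs, r ∈ maximalIdeal R) {M : Type v} [AddCommGroup M] [Module R M]
    [Module.Finite R M] (h : IsRegular M rs) {Q : Ideal R} (hQ : IsAssociatedPrime Q M) :
    (rs.length : WithBot ℕ∞) ≤ ringKrullDim (R ⧸ Q) := by
  induction rs generalizing M Q with
  | nil =>
    have := hQ.isPrime
    simpa using ringKrullDim_nonneg_of_nontrivial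
  | cons x rs ih =>
    rw [isRegular_cons_iff] at h
    obtain ⟨hx, hreg⟩ := h
    have hQp := hQ.isPrime
    obtain ⟨_, m₀, hm₀⟩ := isAssociatedPrime_iff.1 hQ
    have hxm : x ∈ maximalIdeal R := hrs x (by simp)
    let N : Submodule R M := Submodule.torsionBySet R M Q
    have hNmem : ∀ m, m ∈ N ↔ ∀ q ∈ Q, q • m = 0 := fun m => by
      simp [N, Submodule.mem_torsionBySet_iff]
    have hm₀N : m₀ ∈ N := (hNmem _).2 fun q hq => by
      rw [hm₀] at hq
      simpa [Submodule.mem_colon_singleton] using hq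
    have hm₀0 : m₀ ≠ 0 := by
      rintro rfl
      apply hQp.ne_top
      rw [hm₀, Ideal.eq_top_iff_one]
      simp [Submodule.mem_colon_singleton]
    have hnot : ∃ m ∈ N, m ∉ x • (⊤ : Submodule R M) := by
      by_contra! hcon
      have hle : N ≤ (Ideal.span {x}) • N := by
        intro m hm
        obtain ⟨m', -, rfl⟩ := (Submodule.mem_smul_pointwise_iff_exists _ _ _).1 (hcon m hm)
        rw [Submodule.ideal_span_singleton_smul]
        refine Submodule.smul_mem_pointwise_smul _ _ _ ((hNmem _).2 fun q hq => hx ?_)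
        have := (hNmem _).1 hm q hq
        simpa [smul_comm x q] using this
      have hbot := Submodule.eq_bot_of_le_smul_of_le_jacobson_bot (Ideal.span {x}) N
        (IsNoetherian.noetherian N) hle (by
          rw [IsLocalRing.jacobson_eq_maximalIdeal ⊥ bot_ne_top, Ideal.span_singleton_le_iff_mem]
          exact hxm)
      rw [hbot] at hm₀N
      exact hm₀0 (by simpa using hm₀N)
    obtain ⟨m, hmN, hm⟩ := hnot
    let mb : QuotSMulTop x M := Submodule.Quotient.mk m
    have hmb : mb ≠ 0 := by simpa [mb, Submodule.Quotient.mk_eq_zero] using hm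
    obtain ⟨P, hP, hle⟩ := exists_le_isAssociatedPrime_of_isNoetherianRing R mb hmb
    have hQP : Q ≤ P := fun q hq => hle <| by
      rw [Submodule.mem_colon_singleton, Submodule.mem_bot, ← Submodule.Quotient.mk_smul,
        (hNmem _).1 hmN q hq, Submodule.Quotient.mk_zero]
    have hxP : x ∈ P := hle <| by
      rw [Submodule.mem_colon_singleton, Submodule.mem_bot, ← Submodule.Quotient.mk_smul,
        Submodule.Quotient.mk_eq_zero]
      exact Submodule.smul_mem_pointwise_smul _ _ _ trivial
    have hxQ : x ∉ Q := fun hxQ => hm₀0 <| hx <| by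
      simpa using (hNmem _).1 hm₀N x hxQ
    have h1 := ih (fun r hr => hrs r (by simp [hr])) hreg hP
    have h2 : ringKrullDim (R ⧸ P) + 1 ≤ ringKrullDim (R ⧸ Q) :=
      ringKrullDim_succ_le_of_surjective (Ideal.Quotient.factor hQP)
        (Ideal.Quotient.factor_surjective hQP) (r := Ideal.Quotient.mk Q x)
        (mem_nonZeroDivisors_of_ne_zero (by simpa [Ideal.Quotient.eq_zero_iff_mem] using hxQ))
        (by simpa [Ideal.Quotient.eq_zero_iff_mem] using hxP)
    calc ((x :: rs).length : WithBot ℕ∞) = rs.length + 1 := by simp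
      _ ≤ ringKrullDim (R ⧸ P) + 1 := by gcongr
      _ ≤ _ := h2

theorem exists_isRegular_quotSMulTop {M : Type v} [AddCommGroup M] [Module R M]
    [Module.Finite R M] {rs : List R} (hrs : ∀ r ∈ rs, r ∈ maximalIdeal R) (h : IsRegular M rs)
    {k : ℕ} (hk : rs.length = k + 1) {x : R} (hx : x ∈ maximalIdeal R) (hxM : IsSMulRegular M x) :
    ∃ rs' : List R, rs'.length = k ∧ (∀ r ∈ rs', r ∈ maximalIdeal R) ∧
      IsRegular (QuotSMulTop x M) rs' := by
  have hnt := h.nontrivial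
  have hnt' : Nontrivial (QuotSMulTop x M) := by
    rw [QuotSMulTop, Submodule.Quotient.nontrivial_iff]
    intro hcon
    refine (bot_ne_top (α := Submodule R M)) (Submodule.eq_bot_of_le_smul_of_le_jacobson_bot
      (Ideal.span {x}) ⊤ Module.Finite.fg_top ?_ ?_).symm
    · rw [Submodule.ideal_span_singleton_smul, hcon]
    · rwa [IsLocalRing.jacobson_eq_maximalIdeal ⊥ bot_ne_top, Ideal.span_singleton_le_iff_mem]
  have hlt : ∀ (N : Type v) [AddCommGroup N] [Module R N] [Module.Finite R N] [Nontrivial N],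
      maximalIdeal R • (⊤ : Submodule R N) < ⊤ := by
    intro N _ _ _ _
    refine lt_of_le_of_ne le_top fun hcon => (bot_ne_top (α := Submodule R N))
      (Submodule.eq_bot_of_le_smul_of_le_jacobson_bot (maximalIdeal R) ⊤
      Module.Finite.fg_top hcon.ge ?_).symm
    rw [IsLocalRing.jacobson_eq_maximalIdeal ⊥ bot_ne_top]
  let K := ModuleCat.of R (R ⧸ maximalIdeal R)
  have hK : Module.support R K = PrimeSpectrum.zeroLocus (maximalIdeal R) := by
    rw [Module.support_eq_zeroLocus, Ideal.annihilator_quotient]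
  have h1 : ∀ i < rs.length, Subsingleton (Ext K (ModuleCat.of R M) i) :=
    ModuleCat.subsingleton_ext_of_exists_isRegular (maximalIdeal R) K hK.subset
      (ModuleCat.of R M) (hlt M) rs hrs h
  refine ModuleCat.exists_isRegular_of_exists_subsingleton_ext (maximalIdeal R) k
    (ModuleCat.of R (QuotSMulTop x M)) (hlt _) K hK fun i hi => ?_
  have zero1 := AddCommGrpCat.isZero_of_iff_subsingleton.mpr (h1 i (by omega))
  have zero2 := AddCommGrpCat.isZero_of_iff_subsingleton.mpr (h1 (i + 1) (by omega))
  have hxM' : IsSMulRegular (ModuleCat.of R M) x := hxM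
  exact AddCommGrpCat.subsingleton_of_isZero <|
    CategoryTheory.ShortComplex.Exact.isZero_of_both_zeros
      ((Ext.covariant_sequence_exact₃' K hxM'.smulShortComplex_shortExact) i (i + 1) rfl)
      (zero1.eq_zero_of_src _) (zero2.eq_zero_of_tgt _)

/-- In a module of depth at least `k`, elements cutting down the dimension as much as possible
form a regular sequence. -/
theorem isWeaklyRegular_of_ringKrullDim_le {M : Type v} [AddCommGroup M] [Module R M]
    [Module.Finite R M] {rs : List R} (hrs : ∀ r ∈ rs, r ∈ maximalIdeal R) (h : IsRegular M rs)
    {gs : List R} (hgs : ∀ r ∈ gs, r ∈ maximalIdeal R) {D : ℕ}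
    (hD : ringKrullDim (R ⧸ (Module.annihilator R M ⊔ Ideal.ofList gs)) ≤ D)
    (hlen : D + gs.length ≤ rs.length) : IsWeaklyRegular M gs := by
  induction gs generalizing M rs with
  | nil => exact IsWeaklyRegular.nil R M
  | cons x gs ih =>
    obtain ⟨hxm, hgs⟩ : x ∈ maximalIdeal R ∧ ∀ r ∈ gs, r ∈ maximalIdeal R := by simpa using hgs
    have hx : IsSMulRegular M x := by
      by_contra hcon
      have hmem : x ∈ ⋃ p ∈ associatedPrimes R M, (p : Set R) := by
        rw [biUnion_associatedPrimes_eq_compl_regular]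
        exact hcon
      simp only [Set.mem_iUnion, SetLike.mem_coe, exists_prop] at hmem
      obtain ⟨Q, hQ, hxQ⟩ := hmem
      have hQp := hQ.isPrime
      have h1 := length_le_ringKrullDim_quotient_of_isRegular hrs h hQ
      classical
      have hlocal : IsLocalRing (R ⧸ Q) :=
        IsLocalRing.of_surjective' _ Ideal.Quotient.mk_surjective
      let S : Finset (R ⧸ Q) := (gs.map (Ideal.Quotient.mk Q)).toFinset
      have h2 := ringKrullDim_le_ringKrullDim_quotient_add_card S (by
        intro y hy
        simp only [S, List.coe_toFinset, List.mem_map, Set.mem_ofPred_eq] at hy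
        obtain ⟨r, hr, rfl⟩ := hy
        rw [SetLike.mem_coe, IsLocalRing.ringJacobson_eq_maximalIdeal]
        have := IsLocalHom.of_surjective (Ideal.Quotient.mk Q) Ideal.Quotient.mk_surjective
        exact map_nonunit (Ideal.Quotient.mk Q) r (hgs r hr))
      have hAnn : Module.annihilator R M ≤ Q :=
        Submodule.annihilator_top (R := R) (M := M) ▸ hQ.annihilator_le
      have hle : Module.annihilator R M ⊔ Ideal.ofList (x :: gs) ≤
          RingHom.ker ((Ideal.Quotient.mk (Ideal.span (S : Set (R ⧸ Q)))).comp
            (Ideal.Quotient.mk Q)) := by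
        refine sup_le (fun r hr => ?_) (Ideal.span_le.2 fun r hr => ?_)
        · simp [RingHom.mem_ker, Ideal.Quotient.eq_zero_iff_mem.2 (hAnn hr)]
        · rcases List.mem_cons.1 hr with rfl | hr
          · simp [RingHom.mem_ker, Ideal.Quotient.eq_zero_iff_mem.2 hxQ]
          · rw [SetLike.mem_coe, RingHom.mem_ker, RingHom.comp_apply, Ideal.Quotient.eq_zero_iff_mem]
            refine Ideal.subset_span ?_
            simp only [S, List.coe_toFinset, List.mem_map, Set.mem_ofPred_eq]
            exact ⟨r, hr, rfl⟩
      have h3 := ringKrullDim_le_of_surjective (Ideal.Quotient.lift _ _ hle)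
        (Ideal.Quotient.lift_surjective_of_surjective _ hle
          (Ideal.Quotient.mk_surjective.comp Ideal.Quotient.mk_surjective))
      have h4 : S.card ≤ gs.length := (List.toFinset_card_le _).trans (by simp)
      have h5 : ((rs.length : ℕ) : WithBot ℕ∞) ≤ ((D + gs.length : ℕ) : WithBot ℕ∞) := by
        push_cast
        refine h1.trans (h2.trans (add_le_add (h3.trans hD) ?_))
        exact_mod_cast h4
      have h6 : rs.length ≤ D + gs.length := by exact_mod_cast h5
      simp at hlen
      omega
    rw [isWeaklyRegular_cons_iff]
    refine ⟨hx, ?_⟩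
    simp only [List.length_cons] at hlen
    obtain ⟨k, hk⟩ : ∃ k, rs.length = k + 1 := ⟨rs.length - 1, by omega⟩
    obtain ⟨rs', hk', hrs', h'⟩ := exists_isRegular_quotSMulTop hrs h hk hxm hx
    refine ih hrs' h' hgs ?_ (by omega)
    refine le_trans ?_ hD
    have hle : Module.annihilator R M ⊔ Ideal.ofList (x :: gs) ≤
        Module.annihilator R (QuotSMulTop x M) ⊔ Ideal.ofList gs := by
      rw [Ideal.ofList_cons, ← sup_assoc]
      refine sup_le_sup_right (sup_le ?_ ?_) _
      · exact (Submodule.mkQ _).annihilator_le_of_surjective (Submodule.mkQ_surjective _)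
      · rw [Ideal.span_singleton_le_iff_mem]
        exact Module.mem_annihilator.2 fun m => by
          obtain ⟨m, rfl⟩ := Submodule.mkQ_surjective _ m
          rw [← map_smul, Submodule.mkQ_apply, Submodule.Quotient.mk_eq_zero]
          exact Submodule.smul_mem_pointwise_smul _ _ _ trivial
    exact ringKrullDim_le_of_surjective (Ideal.Quotient.factor hle)
      (Ideal.Quotient.factor_surjective hle)

/-- A sequence of `p` elements cutting down the dimension of a local ring of depth `n` to
`n - p` has no relations with coefficients outside the ideal it generates. -/
theorem mem_span_range_of_sum_mul_eq_zero {rs : List R} (hrs : ∀ r ∈ rs, r ∈ maximalIdeal R)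
    (h : IsRegular R rs) {p D : ℕ} {g : Fin p → R} (hg : ∀ i, g i ∈ maximalIdeal R)
    (hD : ringKrullDim (R ⧸ Ideal.span (Set.range g)) ≤ D) (hlen : D + p ≤ rs.length)
    {b : Fin p → R} (hb : ∑ i, b i * g i = 0) (i : Fin p) : b i ∈ Ideal.span (Set.range g) := by
  obtain ⟨l, hl⟩ : ∃ l : List (Fin p), (List.finRange p).Perm (l ++ [i]) := by
    refine ⟨(List.finRange p).erase i, ?_⟩
    exact (List.perm_cons_erase (List.mem_finRange i)).trans (List.perm_append_singleton _ _).symm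
  have hreg : IsWeaklyRegular R ((List.finRange p).map g) := by
    refine isWeaklyRegular_of_ringKrullDim_le hrs h (by simpa using hg) (D := D) ?_ (by simpa)
    have h1 : Module.annihilator R R ⊔ Ideal.ofList ((List.finRange p).map g)
        = Ideal.span (Set.range g) := by
      have h2 : Module.annihilator R R = ⊥ := Module.annihilator_eq_bot.2 inferInstance
      rw [h2, bot_sup_eq, Ideal.ofList]
      congr 1
      ext r
      simp
    rwa [h1]
  have hreg' := IsLocalRing.isWeaklyRegular_of_perm_of_subset_maximalIdeal hreg (hl.map g)
    (by simpa using hg)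
  rw [List.map_append, isWeaklyRegular_append_iff] at hreg'
  have hreg'' := (isWeaklyRegular_singleton_iff _ _).1 hreg'.2
  have hle : Ideal.ofList (l.map g) ≤ Ideal.span (Set.range g) :=
    Ideal.span_mono fun r hr => by
      obtain ⟨j, -, rfl⟩ := List.mem_map.1 hr
      exact ⟨j, rfl⟩
  have hmem : g i * b i ∈ Ideal.ofList (l.map g) := by
    have hsum : ∑ j, b j * g j = (l.map fun j => b j * g j).sum + b i * g i := by
      rw [← List.sum_ofFn, List.ofFn_eq_map, (hl.map _).sum_eq]
      simp
    rw [hsum, add_comm, ← eq_neg_iff_add_eq_zero] at hb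
    rw [mul_comm, hb]
    refine neg_mem (list_sum_mem ?_)
    intro r hr
    obtain ⟨j, hj, rfl⟩ := List.mem_map.1 hr
    exact Ideal.mul_mem_left _ _ (Ideal.subset_span (List.mem_map.2 ⟨j, hj, rfl⟩))
  refine hle ?_
  have hz := @hreg'' (Submodule.Quotient.mk (b i)) 0
  simp only [smul_zero, ← Submodule.Quotient.mk_smul, Submodule.Quotient.mk_eq_zero,
    smul_eq_mul, Ideal.mul_top] at hz
  exact hz hmem

end Depth

section LocalAlgebra

open IsLocalRing

theorem ringKrullDim_quotient_le_zero_of_maximalIdeal_le_radical {R : Type*} [CommRing R]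
    [IsLocalRing R] {J : Ideal R} (h : maximalIdeal R ≤ J.radical) : ringKrullDim (R ⧸ J) ≤ 0 := by
  have : Ring.KrullDimLE 0 (R ⧸ J) := by
    refine Ring.krullDimLE_zero_iff.2 fun P hP => ?_
    have h1 : P.comap (Ideal.Quotient.mk J) = maximalIdeal R := by
      refine le_antisymm (le_maximalIdeal (hP.comap (Ideal.Quotient.mk J)).ne_top) (h.trans ?_)
      refine (hP.comap (Ideal.Quotient.mk J)).radical_le_iff.2 fun x hx => ?_
      rw [Ideal.mem_comap, Ideal.Quotient.eq_zero_iff_mem.2 hx]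
      exact zero_mem _
    have h2 : (P.comap (Ideal.Quotient.mk J)).IsMaximal := h1 ▸ maximalIdeal.isMaximal R
    rw [← Ideal.map_comap_of_surjective _ Ideal.Quotient.mk_surjective P]
    refine (Ideal.map_eq_top_or_isMaximal_of_surjective _ Ideal.Quotient.mk_surjective
      h2).resolve_left ?_
    rw [Ideal.map_comap_of_surjective _ Ideal.Quotient.mk_surjective P]
    exact hP.ne_top
  exact_mod_cast Ring.krullDimLE_iff.1 this

theorem ringKrullDim_le_card_of_maximalIdeal_le_radical {R : Type*} [CommRing R]
    [IsLocalRing R] [IsNoetherianRing R] {s : Finset R} (hs : ∀ x ∈ s, x ∈ maximalIdeal R)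
    (h : maximalIdeal R ≤ (Ideal.span (s : Set R)).radical) : ringKrullDim R ≤ s.card := by
  refine (ringKrullDim_le_ringKrullDim_quotient_add_card s ?_).trans ?_
  · rw [IsLocalRing.ringJacobson_eq_maximalIdeal]
    exact hs
  · calc _ ≤ (0 : WithBot ℕ∞) + s.card := by
          gcongr
          exact ringKrullDim_quotient_le_zero_of_maximalIdeal_le_radical h
      _ = _ := zero_add _

/-- If `q(x)` is a unit whenever `q(0) ≠ 0`, then `x` acts nilpotently on every
finite-dimensional ideal. -/
theorem exists_pow_mul_eq_zero_of_finite {K S : Type*} [Field K] [CommRing S] [Algebra K S]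
    {a : Ideal S} [Module.Finite K a] {x : S}
    (hx : ∀ q : Polynomial K, q.coeff 0 ≠ 0 → IsUnit (Polynomial.aeval x q)) :
    ∃ N : ℕ, ∀ y ∈ a, x ^ N * y = 0 := by
  let T : Module.End K a := Algebra.lsmul K K a x
  have hT : IsIntegral K T := Algebra.IsIntegral.isIntegral T
  obtain ⟨q, hq, hq0⟩ := hT
  obtain ⟨q', hqq, hdvd⟩ := Polynomial.exists_eq_pow_rootMultiplicity_mul_and_not_dvd q hq.ne_zero 0
  refine ⟨q.rootMultiplicity 0, fun y hy => ?_⟩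
  rw [map_zero, sub_zero] at hqq hdvd
  have h1 : Polynomial.aeval T q = 0 := hq0
  have h2 : Polynomial.aeval x q * y = 0 := by
    rw [Polynomial.aeval_algHom_apply] at h1
    exact congrArg Subtype.val (LinearMap.congr_fun h1 ⟨y, hy⟩)
  rw [hqq, map_mul, map_pow, Polynomial.aeval_X, mul_right_comm] at h2
  exact (hx q' fun h => hdvd (Polynomial.X_dvd_iff.2 h)).mul_left_eq_zero.1 h2

/-- If `I / J` is finite-dimensional, where `J` is generated by the entries of the column
`C * g` and the matrix `C` is congruent to `B * H` modulo the complete intersection ideal `I`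
generated by `g`, then `R / I` has dimension at most one. -/
theorem ringKrullDim_quotient_le_one_of_finite {K R : Type*} [Field K] [CommRing R] [Algebra K R]
    [IsLocalRing R] [IsNoetherianRing R] {rs : List R} (hrs : ∀ r ∈ rs, r ∈ maximalIdeal R)
    (hreg : RingTheory.Sequence.IsRegular R rs) {p n D : ℕ} {g : Fin p → R}
    (hg : ∀ i, g i ∈ maximalIdeal R)
    (hD : ringKrullDim (R ⧸ Ideal.span (Set.range g)) ≤ D) (hlen : D + p ≤ rs.length)
    {C B : Matrix (Fin n) (Fin p) R} {H : Matrix (Fin p) (Fin p) R}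
    (hdet : H.det ∈ maximalIdeal R)
    (hC : ∀ k j, C k j - (B * H) k j ∈ Ideal.span (Set.range g))
    (hfin : Module.Finite K (((Ideal.span (Set.range g)).map
      (Ideal.Quotient.mk (Ideal.span (Set.range (C.mulVec g))))).restrictScalars K)) :
    ringKrullDim (R ⧸ Ideal.span (Set.range g)) ≤ 1 := by
  set I := Ideal.span (Set.range g) with hI
  set J := Ideal.span (Set.range (C.mulVec g)) with hJ
  have hIm : I ≤ maximalIdeal R := Ideal.span_le.2 (by rintro _ ⟨i, rfl⟩; exact hg i)
  have hnt : Nontrivial (R ⧸ I) := Ideal.Quotient.nontrivial_iff.2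
    fun h => maximalIdeal.isMaximal R |>.ne_top (top_le_iff.1 (h ▸ hIm))
  have hloc : IsLocalRing (R ⧸ I) := IsLocalRing.of_surjective' _ Ideal.Quotient.mk_surjective
  have hmk : IsLocalHom (Ideal.Quotient.mk I) :=
    IsLocalHom.of_surjective _ Ideal.Quotient.mk_surjective
  have key : ∀ x ∈ maximalIdeal R, ∃ N : ℕ,
      Ideal.Quotient.mk I x ^ N ∈ Ideal.span {Ideal.Quotient.mk I H.det} := by
    intro x hx
    have : Module.Finite K (I.map (Ideal.Quotient.mk J)) := hfin
    obtain ⟨N, hN⟩ := exists_pow_mul_eq_zero_of_finite (K := K) (a := I.map (Ideal.Quotient.mk J))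
      (x := Ideal.Quotient.mk J x) fun q hq => by
        have h1 : Polynomial.aeval (Ideal.Quotient.mk J x) q
            = Ideal.Quotient.mk J (Polynomial.aeval x q) :=
          Polynomial.aeval_algHom_apply (Ideal.Quotient.mkₐ K J) x q
        rw [h1]
        refine IsUnit.map _ ?_
        by_contra hu
        have h2 : Polynomial.aeval x q ∈ maximalIdeal R := hu
        rw [← Polynomial.divX_mul_X_add q, map_add, map_mul, Polynomial.aeval_X,
          Polynomial.aeval_C] at h2
        have h3 := (Ideal.add_mem_iff_right _ ((maximalIdeal R).mul_mem_left _ hx)).1 h2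
        exact h3 ((IsUnit.mk0 _ hq).map _)
    have hmem : ∀ i, ∃ c : Fin n → R, ∑ k, c k * C.mulVec g k = x ^ N * g i := fun i => by
      refine Ideal.mem_span_range_iff_exists_fun.1 (Ideal.Quotient.eq_zero_iff_mem.1 ?_)
      rw [map_mul, map_pow]
      exact hN _ (Ideal.mem_map_of_mem _ (Ideal.subset_span ⟨i, rfl⟩))
    choose A hA using hmem
    have hb : ∀ i j, (x ^ N • (1 : Matrix (Fin p) (Fin p) R) - Matrix.of A * C) i j ∈ I := by
      intro i j
      refine mem_span_range_of_sum_mul_eq_zero hrs hreg hg hD hlen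
        (b := fun j => (x ^ N • (1 : Matrix (Fin p) (Fin p) R) - Matrix.of A * C) i j) ?_ j
      change ((x ^ N • (1 : Matrix (Fin p) (Fin p) R) - Matrix.of A * C).mulVec g) i = 0
      rw [Matrix.sub_mulVec, Matrix.smul_mulVec, Matrix.one_mulVec, ← Matrix.mulVec_mulVec]
      exact sub_eq_zero.2 (hA i).symm
    have hb' : (Ideal.Quotient.mk I).mapMatrix (x ^ N • (1 : Matrix (Fin p) (Fin p) R))
        = (Ideal.Quotient.mk I).mapMatrix (Matrix.of A * C) := by
      ext i j
      exact Ideal.Quotient.eq.2 (hb i j)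
    have hC' : C.map (Ideal.Quotient.mk I) = (B * H).map (Ideal.Quotient.mk I) := by
      ext k j
      exact Ideal.Quotient.eq.2 (hC k j)
    have hAC : (Ideal.Quotient.mk I).mapMatrix (Matrix.of A * C)
        = (Ideal.Quotient.mk I).mapMatrix (Matrix.of A * B) * (Ideal.Quotient.mk I).mapMatrix H := by
      rw [← map_mul, Matrix.mul_assoc, RingHom.mapMatrix_apply, RingHom.mapMatrix_apply,
        Matrix.map_mul, Matrix.map_mul, hC']
    refine ⟨N * p, Ideal.mem_span_singleton'.2
      ⟨((Ideal.Quotient.mk I).mapMatrix (Matrix.of A * B)).det, ?_⟩⟩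
    rw [RingHom.map_det, ← Matrix.det_mul, ← hAC, ← hb', ← RingHom.map_det, Matrix.det_smul]
    simp [pow_mul]
  refine (ringKrullDim_le_card_of_maximalIdeal_le_radical (s := {Ideal.Quotient.mk I H.det})
    ?_ ?_).trans (by simp)
  · simpa using map_nonunit (Ideal.Quotient.mk I) _ hdet
  · intro y hy
    obtain ⟨x, rfl⟩ := Ideal.Quotient.mk_surjective y
    obtain ⟨N, hN⟩ := key x fun hu => hy (hu.map _)
    exact ⟨N, by simpa using hN⟩

end LocalAlgebra

section Singularities

theorem det_ne_zero_of_dotProduct_self {m : ℕ} {H M : Matrix (Fin m) (Fin m) ℂ} (hH : H.IsSymm)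
    (h : ∀ v, v ⬝ᵥ v = M.mulVec v ⬝ᵥ H.mulVec (M.mulVec v)) : H.det ≠ 0 := by
  have hcomm : ∀ a b, b ⬝ᵥ H.mulVec a = a ⬝ᵥ H.mulVec b := fun a b => by
    rw [Matrix.dotProduct_mulVec, ← Matrix.mulVec_transpose, hH.eq, dotProduct_comm]
  have h1 : ∀ v w, v ⬝ᵥ w = M.mulVec v ⬝ᵥ H.mulVec (M.mulVec w) := by
    intro v w
    have h2 := h (v + w)
    simp only [Matrix.mulVec_add, dotProduct_add, add_dotProduct, ← h,
      hcomm (M.mulVec v) (M.mulVec w)] at h2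
    rw [dotProduct_comm w v] at h2
    linear_combination h2 / 2
  have h3 : M.transpose * H * M = 1 := by
    refine Matrix.ext_of_mulVec_single fun i => ?_
    refine dotProduct_eq _ _ fun v => ?_
    rw [Matrix.one_mulVec, dotProduct_comm _ v, dotProduct_comm _ v, h1 v (Pi.single i 1),
      ← Matrix.mulVec_mulVec, ← Matrix.mulVec_mulVec, Matrix.dotProduct_mulVec v, Matrix.vecMul_transpose]
  intro h0
  have := congrArg Matrix.det h3
  simp [h0] at this

theorem det_ne_zero_of_hasAdSingularityAt {n d p : ℕ} {f : Cn n → ℂ} {x : Cn n}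
    (hs : HasAdSingularityAt n d p f x) {g : Fin p → Cn n → ℂ}
    (hg : ∀ i, DifferentiableAt ℂ (g i) x) (hgx : ∀ i, g i x = 0)
    {h : Fin p → Fin p → Cn n → ℂ} (hh : ∀ i j, ContinuousAt (h i j) x)
    (hsymm : ∀ i j, h i j = h j i) (hf : ∀ z, f z = ∑ i, ∑ j, h i j z * g i z * g j z) :
    (Matrix.of fun i j => h i j x).det ≠ 0 := by
  obtain ⟨V, W, φ, ψ, hV, -, h0V, -, hφ0, hφ, -, -, -, -, -, hφf⟩ := hs
  have hfx : f x = 0 := by simp [hf, hgx]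
  subst hφ0
  have hφd : DifferentiableAt ℂ (fun w : Fin p → ℂ => φ (0, w)) 0 :=
    DifferentiableAt.comp (g := φ) (f := fun w : Fin p → ℂ => ((0 : Fin d → ℂ), w)) 0
      (hφ 0 h0V).differentiableAt (by fun_prop)
  have hG : ∀ i, DifferentiableAt ℂ (fun w : Fin p → ℂ => g i (φ (0, w))) 0 := fun i =>
    DifferentiableAt.comp (g := g i) (f := fun w : Fin p → ℂ => φ (0, w)) 0 (hg i) hφd
  let L : (Fin p → ℂ) →ₗ[ℂ] (Fin p → ℂ) :=
    LinearMap.pi fun i => (fderiv ℂ (fun w : Fin p → ℂ => g i (φ (0, w))) 0).toLinearMap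
  refine det_ne_zero_of_dotProduct_self (M := LinearMap.toMatrix' L)
    (Matrix.IsSymm.ext fun i j => by simp [hsymm i j]) fun v => ?_
  have hline : Tendsto (fun t : ℂ => ((0 : Fin d → ℂ), t • v)) (𝓝[≠] 0) (𝓝 0) := by
    refine (Continuous.tendsto' ?_ _ _ ?_).mono_left nhdsWithin_le_nhds
    · fun_prop
    · simp
  have hcurve : Tendsto (fun t : ℂ => φ (0, t • v)) (𝓝[≠] 0) (𝓝 (φ 0)) :=
    (hφ 0 h0V).continuousAt.tendsto.comp hline
  have hslope : ∀ i, Tendsto (fun t : ℂ => t⁻¹ * g i (φ (0, t • v))) (𝓝[≠] 0) (𝓝 (L v i)) := by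
    intro i
    have h1 : HasDerivAt (fun t : ℂ => g i (φ (0, t • v))) (L v i) 0 := by
      have h2 : HasDerivAt (fun t : ℂ => t • v) v 0 := by
        simpa using (hasDerivAt_id (0 : ℂ)).smul_const v
      have h3 : HasFDerivAt (fun w : Fin p → ℂ => g i (φ (0, w)))
          (fderiv ℂ (fun w : Fin p → ℂ => g i (φ (0, w))) 0) ((0 : ℂ) • v) := by
        rw [zero_smul]
        exact (hG i).hasFDerivAt
      exact h3.comp_hasDerivAt 0 h2
    refine (hasDerivAt_iff_tendsto_slope.1 h1).congr fun t => ?_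
    have h0 : g i (φ (0, (0 : ℂ) • v)) = 0 := by
      rw [zero_smul]
      exact hgx i
    rw [slope_def_field, h0, sub_zero, sub_zero, div_eq_inv_mul]
  have hlim : Tendsto (fun t : ℂ => ∑ i, ∑ j, h i j (φ (0, t • v)) *
      (t⁻¹ * g i (φ (0, t • v))) * (t⁻¹ * g j (φ (0, t • v)))) (𝓝[≠] 0)
      (𝓝 (∑ i, ∑ j, h i j (φ 0) * L v i * L v j)) :=
    tendsto_finsetSum _ fun i _ => tendsto_finsetSum _ fun j _ =>
      (((hh i j).tendsto.comp hcurve).mul (hslope i)).mul (hslope j)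
  have hconst : ∑ i, v i ^ 2 = ∑ i, ∑ j, h i j (φ 0) * L v i * L v j := by
    refine tendsto_nhds_unique (tendsto_const_nhds.congr' ?_) hlim
    filter_upwards [hline.eventually (hV.mem_nhds h0V), self_mem_nhdsWithin] with t ht ht0
    have h1 := hφf _ ht
    rw [hfx, sub_zero, hf] at h1
    have ht0' : t ≠ 0 := ht0
    have h2 : ∑ i, v i ^ 2 = t⁻¹ ^ 2 * ∑ i, (t • v) i ^ 2 := by
      rw [Finset.mul_sum]
      refine Finset.sum_congr rfl fun i _ => ?_
      rw [Pi.smul_apply, smul_eq_mul]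
      field_simp
    rw [h2, ← h1, Finset.mul_sum]
    refine Finset.sum_congr rfl fun i _ => ?_
    rw [Finset.mul_sum]
    exact Finset.sum_congr rfl fun j _ => by ring
  rw [LinearMap.toMatrix'_mulVec]
  simp only [dotProduct, Matrix.mulVec, Matrix.of_apply, Finset.mul_sum]
  rw [show ∑ i, v i * v i = ∑ i, v i ^ 2 from Finset.sum_congr rfl fun i _ => (sq _).symm, hconst]
  exact Finset.sum_congr rfl fun i _ => Finset.sum_congr rfl fun j _ => by ring

theorem analyticAt_det {E : Type*} [NormedAddCommGroup E] [NormedSpace ℂ E] {m : ℕ}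
    {h : Fin m → Fin m → E → ℂ} {x : E} (hh : ∀ i j, AnalyticAt ℂ (h i j) x) :
    AnalyticAt ℂ (fun z => (Matrix.of fun i j => h i j z).det) x := by
  simp only [Matrix.det_apply', Matrix.of_apply]
  exact Finset.analyticAt_fun_sum _ fun σ _ => analyticAt_const.mul
    (Finset.analyticAt_fun_prod _ fun i _ => hh _ _)

/-- Fewer than `n` analytic functions vanishing at the origin of `ℂⁿ` have common zeros
arbitrarily close to the origin. -/
theorem exists_ne_zero_forall_eq_zero {n k : ℕ} (hk : k < n) {F : Fin k → (Fin n → ℂ) → ℂ}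
    (hF : ∀ i, AnalyticAt ℂ (F i) 0) (hF0 : ∀ i, F i 0 = 0) {W : Set (Fin n → ℂ)}
    (hW : W ∈ 𝓝 0) : ∃ x ∈ W, x ≠ 0 ∧ ∀ i, F i x = 0 := by
  classical
  by_contra! hcon
  have h1 := maximalIdeal_le_radical_span_of_isolated_zero n k F hF (by
    filter_upwards [hW] with z hz hFz
    by_contra hz0
    obtain ⟨i, hi⟩ := hcon z hz hz0
    exact hi (hFz i))
  have h2 := ringKrullDim_le_card_of_maximalIdeal_le_radical
    (s := Finset.univ.image fun i => mkGerm (F i) (hF i)) (fun x hx => by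
      obtain ⟨i, -, rfl⟩ := Finset.mem_image.1 hx
      exact mem_maximalIdeal_iff_germEval.2 (hF0 i)) (by simpa using h1)
  have h3 : ((Finset.univ.image fun i => mkGerm (F i) (hF i)).card : WithBot ℕ∞) ≤ k := by
    exact_mod_cast Finset.card_image_le.trans (by simp)
  have h4 := (ringKrullDim_analyticGerms_ge n).trans (h2.trans h3)
  exact absurd (by exact_mod_cast h4) (not_le.2 hk)

end Singularities

section Jacobian

theorem idealOfFuns_range {n : ℕ} {ι : Type*} (G : ι → Cn n → ℂ) (hG : ∀ i, AnalyticAt ℂ (G i) 0) :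
    (idealOfFuns (Set.range G) : Ideal (analyticGerms (Fin n → ℂ)))
      = Ideal.span (Set.range fun i => mkGerm (G i) (hG i)) := by
  refine congrArg Ideal.span (Set.ext fun x => ⟨?_, ?_⟩)
  · rintro ⟨_, ⟨i, rfl⟩, hx⟩
    exact ⟨i, Subtype.ext hx.symm⟩
  · rintro ⟨i, rfl⟩
    exact ⟨G i, ⟨i, rfl⟩, rfl⟩

theorem analyticAt_pder {n : ℕ} {f : Cn n → ℂ} (hf : AnalyticAt ℂ f 0) (k : Fin n) :
    AnalyticAt ℂ (pder f k) 0 :=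
  AnalyticAt.comp (g := fun L : (Fin n → ℂ) →L[ℂ] ℂ => L (Pi.single k 1)) (f := fderiv ℂ f)
    (ContinuousLinearMap.analyticAt (ContinuousLinearMap.apply ℂ ℂ (Pi.single k 1 : Fin n → ℂ)) _)
    hf.fderiv

/-- The partial derivatives of a quadratic form in `g` with symmetric coefficients. -/
theorem pder_sum_mul_mul {n p : ℕ} {g : Fin p → Cn n → ℂ} {h : Fin p → Fin p → Cn n → ℂ}
    {z : Cn n} (hg : ∀ i, DifferentiableAt ℂ (g i) z) (hh : ∀ i j, DifferentiableAt ℂ (h i j) z)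
    (hsymm : ∀ i j, h i j = h j i) (k : Fin n) :
    pder (fun z => ∑ i, ∑ j, h i j z * g i z * g j z) k z
      = ∑ j, (∑ i, pder (h i j) k z * g i z + ∑ i, 2 * pder (g i) k z * h i j z) * g j z := by
  have h1 : HasFDerivAt (fun z => ∑ i, ∑ j, h i j z * g i z * g j z)
      (∑ i, ∑ j, ((h i j z * g i z) • fderiv ℂ (g j) z
        + g j z • (h i j z • fderiv ℂ (g i) z + g i z • fderiv ℂ (h i j) z))) z :=
    HasFDerivAt.fun_sum fun i _ => HasFDerivAt.fun_sum fun j _ =>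
      (((hh i j).hasFDerivAt.mul (hg i).hasFDerivAt).mul (hg j).hasFDerivAt)
  have h2 : ∑ i, ∑ j, h i j z * g i z * pder (g j) k z
      = ∑ i, ∑ j, h i j z * g j z * pder (g i) k z := by
    rw [Finset.sum_comm]
    exact Finset.sum_congr rfl fun i _ => Finset.sum_congr rfl fun j _ => by rw [hsymm]
  have h3 : pder (fun z => ∑ i, ∑ j, h i j z * g i z * g j z) k z
      = ∑ i, ∑ j, h i j z * g i z * pder (g j) k z
        + ∑ i, ∑ j, g j z * (h i j z * pder (g i) k z + g i z * pder (h i j) k z) := by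
    rw [pder, h1.fderiv]
    simp [pder, mul_add, Finset.sum_add_distrib]
  rw [h3, h2, ← Finset.sum_add_distrib, Finset.sum_congr rfl fun i _ =>
    (Finset.sum_add_distrib (s := Finset.univ)).symm, Finset.sum_comm]
  refine Finset.sum_congr rfl fun j _ => ?_
  rw [← Finset.sum_add_distrib, Finset.sum_mul]
  exact Finset.sum_congr rfl fun i _ => by ring

theorem mkGerm_eq_toGerm {E : Type*} [NormedAddCommGroup E] [NormedSpace ℂ E] {f : E → ℂ}
    (hf : AnalyticAt ℂ f 0) {F : analyticFuns E} (h : ∀ᶠ z in 𝓝 0, f z = F.1 z) :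
    mkGerm f hf = toGerm F :=
  mkGerm_eq_iff (hg := F.2).2 h

theorem not_finite_quotIJ {n p d : ℕ} (hd : d + p = n) (hd1 : 1 < d) {g : Fin p → Cn n → ℂ}
    (hg : ∀ i, AnalyticAt ℂ (g i) 0) (hg0 : ∀ i, g i 0 = 0)
    (hdim : ringKrullDim (On n ⧸ idealOfFuns (Set.range g)) = d)
    {h : Fin p → Fin p → Cn n → ℂ} (hh : ∀ i j, AnalyticAt ℂ (h i j) 0)
    (hsymm : ∀ i j, h i j = h j i)
    {f : Cn n → ℂ} (hf : ∀ z, f z = ∑ i, ∑ j, h i j z * g i z * g j z)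
    (hdet : (Matrix.of fun i j => h i j 0).det = 0) :
    ¬ Module.Finite ℂ (quotIJ (idealOfFuns (Set.range g)) (jacobianIdeal f)) := by
  intro hfin
  obtain ⟨rs, hlen, hrs, hreg⟩ := exists_isRegular_analyticGerms n
  have hfa : AnalyticAt ℂ f 0 := by
    rw [funext hf]
    exact Finset.analyticAt_fun_sum _ fun i _ => Finset.analyticAt_fun_sum _ fun j _ =>
      ((hh i j).mul (hg i)).mul (hg j)
  let γ : Fin p → analyticFuns (Fin n → ℂ) := fun i => ⟨g i, hg i⟩
  let dγ : Fin n → Fin p → analyticFuns (Fin n → ℂ) := fun k i =>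
    ⟨pder (g i) k, analyticAt_pder (hg i) k⟩
  let η : Fin p → Fin p → analyticFuns (Fin n → ℂ) := fun i j => ⟨h i j, hh i j⟩
  let dη : Fin n → Fin p → Fin p → analyticFuns (Fin n → ℂ) := fun k i j =>
    ⟨pder (h i j) k, analyticAt_pder (hh i j) k⟩
  let H : Matrix (Fin p) (Fin p) (analyticGerms (Fin n → ℂ)) := Matrix.of fun i j => toGerm (η i j)
  let B : Matrix (Fin n) (Fin p) (analyticGerms (Fin n → ℂ)) :=
    Matrix.of fun k i => 2 * toGerm (dγ k i)
  let C : Matrix (Fin n) (Fin p) (analyticGerms (Fin n → ℂ)) := Matrix.of fun k j =>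
    ∑ i, toGerm (dη k i j) * toGerm (γ i) + (B * H) k j
  have hJ : (jacobianIdeal f : Ideal (analyticGerms (Fin n → ℂ)))
      = Ideal.span (Set.range (C.mulVec fun i => toGerm (γ i))) := by
    refine (idealOfFuns_range (pder f) (analyticAt_pder hfa)).trans ?_
    refine congrArg (fun F => Ideal.span (Set.range F)) (funext fun k => ?_)
    have h1 : C.mulVec (fun i => toGerm (γ i)) k
        = toGerm (∑ j, (∑ i, dη k i j * γ i + ∑ i, 2 * dγ k i * η i j) * γ j) := by
      simp only [Matrix.mulVec, dotProduct, map_sum, map_mul, map_add, C, B, H, Matrix.of_apply,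
        Matrix.mul_apply, map_ofNat]
    rw [h1]
    refine mkGerm_eq_toGerm _ ?_
    filter_upwards [eventually_all.2 fun i => (hg i).eventually_analyticAt,
      eventually_all.2 fun i => eventually_all.2 fun j => (hh i j).eventually_analyticAt]
      with z hgz hhz
    rw [funext hf, pder_sum_mul_mul (fun i => (hgz i).differentiableAt)
      (fun i j => (hhz i j).differentiableAt) hsymm, ← evalAt_apply]
    simp only [map_sum, map_mul, map_add, map_ofNat]
    rfl
  have hI : (idealOfFuns (Set.range g) : Ideal (analyticGerms (Fin n → ℂ)))
      = Ideal.span (Set.range fun i => toGerm (γ i)) := idealOfFuns_range g hg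
  have hdim' : ringKrullDim (analyticGerms (Fin n → ℂ) ⧸
      Ideal.span (Set.range fun i => toGerm (γ i))) = d := by
    rw [← hI]
    exact hdim
  have hHdet : H.det ∈ IsLocalRing.maximalIdeal (analyticGerms (Fin n → ℂ)) := by
    rw [mem_maximalIdeal_iff_germEval, RingHom.map_det]
    exact hdet
  have hfin' : Module.Finite ℂ (((Ideal.span (Set.range fun i => toGerm (γ i))).map
      (Ideal.Quotient.mk (Ideal.span (Set.range (C.mulVec fun i => toGerm (γ i)))))).restrictScalars
        ℂ) := by
    rw [← hI, ← hJ]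
    exact hfin
  have hle := ringKrullDim_quotient_le_one_of_finite hrs hreg (g := fun i => toGerm (γ i))
    (fun i => mem_maximalIdeal_iff_germEval.2 (hg0 i)) hdim'.le (by omega) hHdet
    (fun k j => by
      change (∑ i, toGerm (dη k i j) * toGerm (γ i) + (B * H) k j) - (B * H) k j ∈ _
      rw [add_sub_cancel_right]
      exact Ideal.sum_mem _ fun i _ => Ideal.mul_mem_left _ _ (Ideal.subset_span ⟨i, rfl⟩)) hfin'
  rw [hdim'] at hle
  exact absurd (by exact_mod_cast hle) (not_le.2 hd1)

theorem exists_not_hasAdSingularityAt {n p d : ℕ} (hd : d + p = n) (hd1 : 1 < d)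
    {U : Set (Cn n)} (hU : IsOpen U) (h0U : (0 : Cn n) ∈ U)
    {g : Fin p → Cn n → ℂ} (hg : ∀ i, AnalyticOnNhd ℂ (g i) U) (hg0 : ∀ i, g i 0 = 0)
    {h : Fin p → Fin p → Cn n → ℂ} (hh : ∀ i j, AnalyticOnNhd ℂ (h i j) U)
    (hsymm : ∀ i j, h i j = h j i)
    {f : Cn n → ℂ} (hf : ∀ z, f z = ∑ i, ∑ j, h i j z * g i z * g j z)
    (hdet : (Matrix.of fun i j => h i j 0).det = 0) {W : Set (Cn n)} (hW : W ∈ 𝓝 0) :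
    ∃ x ∈ W, x ≠ 0 ∧ (∀ i, g i x = 0) ∧ ¬ HasAdSingularityAt n d p f x := by
  obtain ⟨x, ⟨hxW, hxU⟩, hx0, hx⟩ := exists_ne_zero_forall_eq_zero (n := n) (k := p + 1) (by omega)
    (F := Fin.cons (fun z => (Matrix.of fun i j => h i j z).det) g)
    (Fin.cases (analyticAt_det fun i j => hh i j 0 h0U) fun i => hg i 0 h0U)
    (Fin.cases hdet hg0) (inter_mem hW (hU.mem_nhds h0U))
  exact ⟨x, hxW, hx0, fun i => hx i.succ, fun hs => det_ne_zero_of_hasAdSingularityAt hs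
    (fun i => (hg i x hxU).differentiableAt) (fun i => hx i.succ)
    (fun i j => (hh i j x hxU).continuousAt) hsymm hf (hx 0)⟩

end Jacobian

/-- **Proposition 3.1.** Let `I = (g₁, …, g_p)` define a reduced complete
intersection `V(I)` of dimension `d = n - p > 1`, let
`f = Σᵢⱼ hᵢⱼ gᵢ gⱼ` with `[H] = (hᵢⱼ)` symmetric, and assume the critical
locus `S(f)` coincides with `V(I)` near `0`.  If `det [H(0)] = 0`, then
(i) every neighborhood of `0` contains points `x ≠ 0` of `V(I)` at which `f`
does not have a singularity of type `A(d)`, and (ii) `I/J(f)` is not a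
finite-dimensional `ℂ`-vector space, i.e. `j(f) = ∞`. -/
theorem proposition_3_1 (n p : ℕ) (hp : 1 ≤ p) (hpn : p < n)
    (d : ℕ) (hd : d = n - p) (hd1 : 1 < d)
    (U : Set (Cn n)) (hU : IsOpen U) (h0U : (0 : Cn n) ∈ U)
    (g : Fin p → Cn n → ℂ) (hg : ∀ i, AnalyticOnNhd ℂ (g i) U)
    (hg0 : ∀ i, g i 0 = 0)
    (I : Ideal (On n)) (hI : I = idealOfFuns (Set.range g))
    (hred : IsReduced ((On n) ⧸ I))
    (hdim : ringKrullDim ((On n) ⧸ I) = d)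
    (h : Fin p → Fin p → Cn n → ℂ) (hh : ∀ i j, AnalyticOnNhd ℂ (h i j) U)
    (hsymm : ∀ i j, h i j = h j i)
    (f : Cn n → ℂ) (hf : ∀ z, f z = ∑ i, ∑ j, h i j z * g i z * g j z)
    (hSf : ∀ᶠ z in 𝓝 (0 : Cn n), (fderiv ℂ f z = 0 ↔ ∀ i, g i z = 0))
    (hdet : (Matrix.of fun i j => h i j 0).det = 0) :
    (∀ W ∈ 𝓝 (0 : Cn n), ∃ x ∈ W, x ≠ 0 ∧ (∀ i, g i x = 0) ∧
        ¬ HasAdSingularityAt n d (n - d) f x) ∧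
    ¬ Module.Finite ℂ (quotIJ I (jacobianIdeal f)) := by
  subst hI
  have hdp : d + p = n := by omega
  refine ⟨fun W hW => ?_, not_finite_quotIJ hdp hd1 (fun i => hg i 0 h0U) hg0 hdim
    (fun i j => hh i j 0 h0U) hsymm hf hdet⟩
  rw [show n - d = p by omega]
  exact exists_not_hasAdSingularityAt hdp hd1 hU h0U hg hg0 hh hsymm hf hdet hW

end
end
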